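/- arXiv:2001.10747 — 5 statements merged into one kernel-verified Lean document; each statement's English description precedes it below -/
import Mathlib

section
/- Let R be a commutative ring with total ring of quotients Q. A Q-module B belongs to ℬ(Q) if and only if B, viewed as an R-module by restriction along R → Q, belongs to ℬ(R); that is, ℬ(R) ∩ Mod-Q = ℬ(Q). -/
universe u

open MulOpposite Function

/-- An `A`-module `M` has projective dimension at most 1, i.e. there is a short exact
sequence `0 → ker g → P → M → 0` with `P` and `ker g` projective. -/
def ProjDimLE1 (A : Type u) [Ring A] (M : Type u) [AddCommGroup M] [Module A M] : Prop :=
  ∃ (P : ModuleCat.{u} A) (g : P →ₗ[A] M), Module.Projective A P ∧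
    Function.Surjective g ∧ Module.Projective A (LinearMap.ker g)

/-- `Ext¹_A(X, Y) = 0`: every short exact sequence `0 → Y → E → X → 0` splits. -/
def Ext1Vanishes (A : Type u) [Ring A] (X Y : Type u) [AddCommGroup X] [Module A X]
    [AddCommGroup Y] [Module A Y] : Prop :=
  ∀ (E : Type u) [AddCommGroup E] [Module A E], ∀ (i : Y →ₗ[A] E) (p : E →ₗ[A] X),
    Function.Injective i → Function.Surjective p → LinearMap.range i = LinearMap.ker p →
    ∃ s : X →ₗ[A] E, p.comp s = LinearMap.id

noncomputable section

open TensorProduct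

namespace BClassAux

/-- finitely supported functions into a product -/
def finsuppProd (A : Type u) [Ring A] (P K : Type u) [AddCommGroup P] [Module A P]
    [AddCommGroup K] [Module A K] : (ℕ →₀ (P × K)) ≃ₗ[A] (ℕ →₀ P) × (ℕ →₀ K) :=
  LinearEquiv.ofLinearMap
    ((Finsupp.mapRange.linearMap (LinearMap.fst A P K)).prod
      (Finsupp.mapRange.linearMap (LinearMap.snd A P K)))
    ((Finsupp.mapRange.linearMap (LinearMap.inl A P K)).coprod
      (Finsupp.mapRange.linearMap (LinearMap.inr A P K)))
    (by
      apply LinearMap.ext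
      rintro ⟨x, y⟩
      refine Prod.ext ?_ ?_ <;> ext n <;> simp)
    (by
      apply LinearMap.ext
      intro x
      ext n <;> simp)

/-- shifting -/
def shiftEquiv (A : Type u) [Ring A] (P : Type u) [AddCommGroup P] [Module A P] :
    (P × (ℕ →₀ P)) ≃ₗ[A] (ℕ →₀ P) :=
  ((Finsupp.uniqueLinearEquiv A P ()).symm.prodCongr (LinearEquiv.refl A _)).trans
    ((Finsupp.sumFinsuppLEquivProdFinsupp A).symm.trans
      (Finsupp.domLCongr ((Equiv.sumComm Unit ℕ).trans Equiv.natSumPUnitEquivNat)))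

theorem exists_free (A : Type u) [Ring A] (P : Type u) [AddCommGroup P] [Module A P]
    [Module.Projective A P] :
    ∃ G : ModuleCat.{u} A, Module.Free A G ∧ Module.Free A (P × G) := by
  obtain ⟨s, hs⟩ := Module.projective_def'.1 (inferInstance : Module.Projective A P)
  set r := Finsupp.linearCombination A (id : P → P) with hr
  have hs' : ∀ x, r (s x) = x := fun x => LinearMap.congr_fun hs x
  let K := LinearMap.ker r
  let e : (P × K) ≃ₗ[A] (P →₀ A) := LinearEquiv.ofBijective (s.coprod K.subtype) (by
    constructor
    · rw [injective_iff_map_eq_zero]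
      rintro ⟨x, k⟩ h
      have h1 : s x + (k : P →₀ A) = 0 := h
      have h2 := congrArg r h1
      rw [map_add, hs', LinearMap.mem_ker.1 k.2, map_zero, add_zero] at h2
      subst h2
      have : k = 0 := by simpa using h1
      simp [this]
    · intro y
      refine ⟨(r y, ⟨y - s (r y), ?_⟩), ?_⟩
      · simp [K, hs']
      · simp)
  let E1 : (ℕ →₀ (P →₀ A)) ≃ₗ[A] (ℕ →₀ P) × (ℕ →₀ K) :=
    (Finsupp.mapRange.linearEquiv e.symm).trans (finsuppProd A P K)
  let E : (P × (ℕ →₀ (P →₀ A))) ≃ₗ[A] (ℕ →₀ (P →₀ A)) :=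
    ((LinearEquiv.refl A P).prodCongr E1).trans
      ((LinearEquiv.prodAssoc A P (ℕ →₀ P) (ℕ →₀ K)).symm.trans
        (((shiftEquiv A P).prodCongr (LinearEquiv.refl A _)).trans E1.symm))
  exact ⟨ModuleCat.of A (ℕ →₀ (P →₀ A)), inferInstanceAs (Module.Free A (ℕ →₀ (P →₀ A))),
    Module.Free.of_equiv E.symm⟩

section crit
variable {A : Type u} [Ring A] {K P M B : Type u} [AddCommGroup K] [Module A K]
  [AddCommGroup P] [Module A P] [AddCommGroup M] [Module A M] [AddCommGroup B] [Module A B]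

theorem extend_of_ext (j : K →ₗ[A] P) (g : P →ₗ[A] M) (hj : Injective j) (hg : Surjective g)
    (hex : LinearMap.range j = LinearMap.ker g) (h : Ext1Vanishes A M B) (f : K →ₗ[A] B) :
    ∃ t : P →ₗ[A] B, t.comp j = f := by
  let N : Submodule A (B × P) := LinearMap.range (f.prod (-j))
  let i : B →ₗ[A] (B × P) ⧸ N := N.mkQ.comp (LinearMap.inl A B P)
  have hgj : ∀ k, g (j k) = 0 := fun k => by
    have : j k ∈ LinearMap.ker g := hex ▸ LinearMap.mem_range_self j k
    exact this
  let p : ((B × P) ⧸ N) →ₗ[A] M := N.liftQ (g.comp (LinearMap.snd A B P)) (by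
    rintro _ ⟨k, rfl⟩
    simp [hgj])
  have hi : Injective i := by
    rw [injective_iff_map_eq_zero]
    intro b hb
    have : (b, (0 : P)) ∈ N := (Submodule.Quotient.mk_eq_zero N).1 hb
    obtain ⟨k, hk⟩ := this
    have h1 : f k = b := congrArg Prod.fst hk
    have h2 : -j k = 0 := congrArg Prod.snd hk
    have h3 : k = 0 := hj (by simpa using h2)
    rw [← h1, h3, map_zero]
  have hp : Surjective p := by
    intro m
    obtain ⟨x, rfl⟩ := hg m
    exact ⟨N.mkQ (0, x), rfl⟩
  have hmk : ∀ k, N.mkQ (0, j k) = i (f k) := by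
    intro k
    have : N.mkQ (f k, -j k) = 0 := (Submodule.Quotient.mk_eq_zero N).2 ⟨k, rfl⟩
    have h2 : ((f k, (0 : P)) : B × P) = (f k, - j k) + (0, j k) := by simp
    change _ = N.mkQ (f k, 0)
    rw [h2, map_add, this, zero_add]
  have hr : LinearMap.range i = LinearMap.ker p := by
    apply le_antisymm
    · rintro _ ⟨b, rfl⟩
      change g 0 = 0
      simp
    · intro y hy
      obtain ⟨⟨b, x⟩, rfl⟩ := N.mkQ_surjective y
      have : g x = 0 := hy
      have hx : x ∈ LinearMap.range j := hex ▸ this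
      obtain ⟨k, rfl⟩ := hx
      refine ⟨b + f k, ?_⟩
      rw [map_add, ← hmk]
      change N.mkQ (b, 0) + _ = _
      rw [← map_add]
      simp
  obtain ⟨s, hs⟩ := h _ i p hi hp hr
  have hs' : ∀ m, p (s m) = m := fun m => LinearMap.congr_fun hs m
  -- the retraction
  let q : P →ₗ[A] (B × P) ⧸ N := N.mkQ.comp (LinearMap.inr A B P) - s.comp g
  have hq : ∀ x, q x ∈ LinearMap.range i := by
    intro x
    rw [hr, LinearMap.mem_ker]
    change p (N.mkQ (0, x) - s (g x)) = 0
    rw [map_sub, hs']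
    change g x - g x = 0
    simp
  let t : P →ₗ[A] B := (LinearEquiv.ofInjective i hi).symm.toLinearMap.comp (q.codRestrict _ hq)
  have ht : ∀ x, i (t x) = q x := by
    intro x
    have := LinearEquiv.apply_symm_apply (LinearEquiv.ofInjective i hi) (q.codRestrict _ hq x)
    exact congrArg Subtype.val this
  refine ⟨t, LinearMap.ext fun k => hi ?_⟩
  change i (t (j k)) = _
  rw [ht]
  change N.mkQ (0, j k) - s (g (j k)) = _
  rw [hgj, map_zero, sub_zero, hmk]

theorem ext_of_extend (j : K →ₗ[A] P) (g : P →ₗ[A] M) [Module.Projective A P]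
    (hg : Surjective g)
    (hex : LinearMap.range j = LinearMap.ker g)
    (h : ∀ f : K →ₗ[A] B, ∃ t : P →ₗ[A] B, t.comp j = f) : Ext1Vanishes A M B := by
  intro E _ _ i p hi hp hr
  have hgj : ∀ k, g (j k) = 0 := fun k => by
    have : j k ∈ LinearMap.ker g := hex ▸ LinearMap.mem_range_self j k
    exact this
  have hpi : ∀ k, p (i k) = 0 := fun k => by
    have : i k ∈ LinearMap.ker p := hr ▸ LinearMap.mem_range_self i k
    exact this
  obtain ⟨l, hl⟩ := Module.projective_lifting_property p g hp
  have hl' : ∀ x, p (l x) = g x := fun x => LinearMap.congr_fun hl x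
  have hq : ∀ k, (l.comp j) k ∈ LinearMap.range i := by
    intro k
    rw [hr, LinearMap.mem_ker, LinearMap.comp_apply, hl', hgj]
  let f : K →ₗ[A] B :=
    (LinearEquiv.ofInjective i hi).symm.toLinearMap.comp ((l.comp j).codRestrict _ hq)
  have hf : ∀ x, i (f x) = l (j x) := by
    intro x
    have := LinearEquiv.apply_symm_apply (LinearEquiv.ofInjective i hi)
      ((l.comp j).codRestrict _ hq x)
    exact congrArg Subtype.val this
  obtain ⟨t, ht⟩ := h f
  let d : P →ₗ[A] E := l - i.comp t
  have hd : LinearMap.ker g ≤ LinearMap.ker d := by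
    rw [← hex]
    rintro _ ⟨k, rfl⟩
    have : t (j k) = f k := LinearMap.congr_fun ht k
    change l (j k) - i (t (j k)) = 0
    rw [this, hf, sub_self]
  let e := g.quotKerEquivOfSurjective hg
  refine ⟨((LinearMap.ker g).liftQ d hd).comp e.symm.toLinearMap, LinearMap.ext fun m => ?_⟩
  obtain ⟨x, rfl⟩ := hg m
  have : e.symm (g x) = (LinearMap.ker g).mkQ x := by
    rw [LinearEquiv.symm_apply_eq]; rfl
  change p (((LinearMap.ker g).liftQ d hd) (e.symm (g x))) = g x
  rw [this]
  change p (l x - i (t x)) = g x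
  rw [map_sub, hl', hpi, sub_zero]

theorem pd_of_exact (j : K →ₗ[A] P) (g : P →ₗ[A] M) [Module.Projective A P]
    [Module.Projective A K] (hj : Injective j) (hg : Surjective g)
    (hex : LinearMap.range j = LinearMap.ker g) : ProjDimLE1 A M := by
  refine ⟨ModuleCat.of A P, g, ‹_›, hg, ?_⟩
  exact Module.Projective.of_equiv
    ((LinearEquiv.ofInjective j hj).trans (LinearEquiv.ofEq _ _ hex))

end crit

section main
variable {R : Type u} [CommRing R] {Q : Type u} [CommRing Q]
    [Algebra R Q] [IsFractionRing R Q]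
    {B : Type u} [AddCommGroup B] [Module R B] [Module Q B] [IsScalarTower R Q B]

theorem free_extend
    (H : ∀ P : ModuleCat.{u} R, ProjDimLE1 R (P : Type u) → Ext1Vanishes R (P : Type u) B)
    {α β : Type u} (j : (α →₀ Q) →ₗ[Q] (β →₀ Q)) (hj : Injective j) (f : (α →₀ Q) →ₗ[Q] B) :
    ∃ t : (β →₀ Q) →ₗ[Q] B, t.comp j = f := by
  let ι : (β →₀ R) →ₗ[R] (β →₀ Q) := Finsupp.mapRange.linearMap (Algebra.linearMap R Q)
  have hinj : Injective (algebraMap R Q) := IsFractionRing.injective R Q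
  have key : ∀ a : α, ∃ (s : nonZeroDivisors R) (c : β →₀ R),
      ι c = (s : R) • j (Finsupp.single a 1) := by
    intro a
    classical
    set v := j (Finsupp.single a 1)
    obtain ⟨s, hs⟩ := IsLocalization.exist_integer_multiples (nonZeroDivisors R) v.support v
    choose! w hw using hs
    refine ⟨s, Finsupp.onFinset v.support (fun b => if b ∈ v.support then w b else 0)
      (fun b hb => by by_contra h; simp [h] at hb), ?_⟩
    ext b
    by_cases hb : b ∈ v.support
    · have := hw b hb
      simp only [ι, Finsupp.mapRange.linearMap_apply, Finsupp.mapRange_apply,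
        Finsupp.onFinset_apply, if_pos hb, Algebra.linearMap_apply, this, Finsupp.smul_apply]
    · have : v b = 0 := by simpa using hb
      simp [ι, this]
  choose s c hc using key
  let φ : (α →₀ R) →ₗ[R] (β →₀ R) := Finsupp.linearCombination R c
  let D : (α →₀ R) →ₗ[R] (α →₀ Q) :=
    Finsupp.linearCombination R (fun a => Finsupp.single a (algebraMap R Q (s a)))
  have hDa : ∀ x a, D x a = algebraMap R Q (x a * s a) := by
    intro x a
    induction x using Finsupp.induction_linear with
    | zero => simp
    | add x y hx hy => rw [map_add, Finsupp.add_apply, hx, hy, Finsupp.add_apply, add_mul, map_add]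
    | single b r =>
      classical
      simp only [D, Finsupp.linearCombination_single, Finsupp.smul_apply, Finsupp.single_apply,
        Algebra.smul_def]
      split_ifs with h
      · subst h; simp
      · simp
  have hιφ : ι.comp φ = (j.restrictScalars R).comp D := by
    apply Finsupp.lhom_ext'
    intro a
    apply LinearMap.ext_ring
    simp only [LinearMap.comp_apply, Finsupp.lsingle_apply, φ, D,
      Finsupp.linearCombination_single, one_smul, hc, LinearMap.restrictScalars_apply]
    rw [← LinearMap.map_smul_of_tower]
    simp [Algebra.smul_def]
  have hφ : Injective φ := by
    rw [injective_iff_map_eq_zero]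
    intro x hx
    have h1 : j (D x) = 0 := by
      have := LinearMap.congr_fun hιφ x
      simp only [LinearMap.comp_apply, hx, map_zero] at this
      exact this.symm
    have h2 : D x = 0 := hj (by simpa using h1)
    ext a
    have h3 := hDa x a
    rw [h2, Finsupp.zero_apply] at h3
    have h4 : x a * s a = 0 := hinj (by rw [← h3, map_zero])
    exact (mul_right_mem_nonZeroDivisors_eq_zero_iff (s a).2).1 h4
  let M := (β →₀ R) ⧸ LinearMap.range φ
  have hex : LinearMap.range φ = LinearMap.ker (LinearMap.range φ).mkQ :=
    (Submodule.ker_mkQ _).symm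
  have hE := H (ModuleCat.of R M)
    (pd_of_exact φ (LinearMap.range φ).mkQ hφ (Submodule.mkQ_surjective _) hex)
  obtain ⟨t, ht⟩ := extend_of_ext φ (LinearMap.range φ).mkQ hφ (Submodule.mkQ_surjective _) hex hE
    ((f.restrictScalars R).comp D)
  let T : (β →₀ Q) →ₗ[Q] B := Finsupp.linearCombination Q (fun b => t (Finsupp.single b 1))
  have hT : (T.restrictScalars R).comp ι = t := by
    apply Finsupp.lhom_ext'
    intro b
    apply LinearMap.ext_ring
    simp [T, ι]
  refine ⟨T, ?_⟩
  apply Finsupp.lhom_ext'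
  intro a
  apply LinearMap.ext_ring
  change T (j (Finsupp.single a 1)) = f (Finsupp.single a 1)
  have e1 : T (ι (c a)) = t (c a) := LinearMap.congr_fun hT (c a)
  have e2 : t (φ (Finsupp.single a 1)) = f (D (Finsupp.single a 1)) :=
    LinearMap.congr_fun ht _
  have e3 : φ (Finsupp.single a 1) = c a := by simp [φ]
  have e4 : D (Finsupp.single a 1) = algebraMap R Q (s a) • Finsupp.single a 1 := by
    simp [D, Algebra.smul_def]
  rw [e3, e4, map_smul] at e2
  rw [hc, e2, ← algebraMap_smul Q, map_smul] at e1
  exact (IsLocalization.map_units Q (s a)).smul_left_cancel.1 e1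

theorem forward
    (H : ∀ P : ModuleCat.{u} R, ProjDimLE1 R (P : Type u) → Ext1Vanishes R (P : Type u) B)
    (N : Type u) [AddCommGroup N] [Module Q N] (hN : ProjDimLE1 Q N) : Ext1Vanishes Q N B := by
  obtain ⟨P, g, hP, hg, hK⟩ := hN
  obtain ⟨G0, hG0, hPG⟩ := exists_free Q P
  obtain ⟨G1, hG1, hKG⟩ := exists_free Q (LinearMap.ker g)
  refine ext_of_extend (LinearMap.ker g).subtype g hg (by simp) fun f => ?_
  let G := G0 × G1
  have f0 : Module.Free Q (P × G) :=
    Module.Free.of_equiv (LinearEquiv.prodAssoc Q P G0 G1)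
  have f1 : Module.Free Q (LinearMap.ker g × G) :=
    Module.Free.of_equiv ((LinearEquiv.prodAssoc Q (LinearMap.ker g) G1 G0).trans
      ((LinearEquiv.refl Q _).prodCongr (LinearEquiv.prodComm Q G1 G0)))
  let e0 := (Module.Free.chooseBasis Q (P × G)).repr
  let e1 := (Module.Free.chooseBasis Q (LinearMap.ker g × G)).repr
  let J : (LinearMap.ker g × G) →ₗ[Q] (P × G) := (LinearMap.ker g).subtype.prodMap LinearMap.id
  have hJ : Injective J := Prod.map_injective.2 ⟨Subtype.val_injective, injective_id⟩
  obtain ⟨t, ht⟩ := free_extend (R := R) H (e0.toLinearMap.comp (J.comp e1.symm.toLinearMap))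
    (e0.injective.comp (hJ.comp e1.symm.injective))
    ((f.comp (LinearMap.fst Q _ G)).comp e1.symm.toLinearMap)
  refine ⟨(t.comp e0.toLinearMap).comp (LinearMap.inl Q P G), LinearMap.ext fun k => ?_⟩
  have := LinearMap.congr_fun ht (e1 (k, 0))
  simpa [J] using this

theorem backward
    (H : ∀ P : ModuleCat.{u} Q, ProjDimLE1 Q (P : Type u) → Ext1Vanishes Q (P : Type u) B)
    (N : Type u) [AddCommGroup N] [Module R N] (hN : ProjDimLE1 R N) : Ext1Vanishes R N B := by
  obtain ⟨P, g, hP, hg, hK⟩ := hN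
  refine ext_of_extend (LinearMap.ker g).subtype g hg (by simp) fun f => ?_
  have : Module.Flat R Q := IsLocalization.flat Q (nonZeroDivisors R)
  let j := (LinearMap.ker g).subtype.baseChange Q
  let g' := g.baseChange Q
  have hj : Injective j :=
    Module.Flat.lTensor_preserves_injective_linearMap _ Subtype.val_injective
  have hg' : Surjective g' := LinearMap.lTensor_surjective Q hg
  have hex : LinearMap.range j = LinearMap.ker g' := by
    have := lTensor_exact Q (g.exact_subtype_ker_map) hg
    ext x
    exact (this x).symm
  obtain ⟨t, ht⟩ := extend_of_ext j g' hj hg' hex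
    (H (ModuleCat.of Q (Q ⊗[R] N)) (pd_of_exact j g' hj hg' hex)) (f.liftBaseChange Q)
  refine ⟨(t.restrictScalars R).comp (TensorProduct.mk R Q P 1), LinearMap.ext fun k => ?_⟩
  have := LinearMap.congr_fun ht (1 ⊗ₜ k)
  simpa [j] using this

end main

end BClassAux

end

/-- **Lemma 3.5.** Let `R` be a commutative ring with total ring of quotients `Q`. A
`Q`-module `B` belongs to `ℬ(Q)` if and only if `B`, viewed as an `R`-module by
restriction along `R → Q`, belongs to `ℬ(R)`; that is, `ℬ(R) ∩ Mod-Q = ℬ(Q)`. -/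
theorem BClass_inter_QMod (R : Type u) [CommRing R] (Q : Type u) [CommRing Q]
    [Algebra R Q] [IsFractionRing R Q]
    (B : Type u) [AddCommGroup B] [Module R B] [Module Q B] [IsScalarTower R Q B] :
    (∀ P : ModuleCat.{u} R, ProjDimLE1 R (P : Type u) → Ext1Vanishes R (P : Type u) B) ↔
    (∀ P : ModuleCat.{u} Q, ProjDimLE1 Q (P : Type u) → Ext1Vanishes Q (P : Type u) B) := by
  exact ⟨fun H P hP => BClassAux.forward H P hP, fun H P hP => BClassAux.backward H P hP⟩
end

section
/- Let R be a commutative ring. If the class 𝒫₁(R) of R-modules of projective dimension at most 1 is closed under direct limits, then for every regular non-unit element r of R the quotient ring R/rR is a perfect ring (i.e. every flat R/rR-module is projective). -/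
universe u

open MulOpposite Function

/-- The class `𝒫₁(A)` of modules of projective dimension at most one. -/
def P1Class (A : Type u) [Ring A] : Set (ModuleCat.{u} A) := {M | ProjDimLE1 A M}

/-- `M` is a direct limit (directed colimit) of a direct system of modules from the
class `C`. -/
def IsDirectLimitOf (A : Type u) [Ring A] (C : Set (ModuleCat.{u} A)) (M : Type u)
    [AddCommGroup M] [Module A M] : Prop :=
  ∃ (ι : Type u) (le : ι → ι → Prop) (htrans : ∀ i j k, le i j → le j k → le i k),
    Nonempty ι ∧
    (∀ i, le i i) ∧
    (∀ i j, ∃ k, le i k ∧ le j k) ∧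
    ∃ (G : ι → ModuleCat.{u} A) (f : ∀ i j, le i j → ((G i : Type u) →ₗ[A] (G j : Type u)))
      (g : ∀ i, (G i : Type u) →ₗ[A] M),
      (∀ i, G i ∈ C) ∧
      (∀ i (h : le i i), f i i h = LinearMap.id) ∧
      (∀ i j k (hij : le i j) (hjk : le j k),
        (f j k hjk).comp (f i j hij) = f i k (htrans i j k hij hjk)) ∧
      (∀ i j (hij : le i j), (g j).comp (f i j hij) = g i) ∧
      (∀ m : M, ∃ i x, g i x = m) ∧
      (∀ i x, g i x = 0 → ∃ j hij, f i j hij x = 0)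

def DCCp (S : Type u) [CommRing S] : Prop :=
  ∀ a : ℕ → S, ∃ k, (∏ i ∈ Finset.range (k+1), a i) ∣ ∏ i ∈ Finset.range k, a i

lemma DCCp.min {S : Type u} [CommRing S] (h : DCCp S) (T : S → Prop) (h1 : T 1) :
    ∃ x, T x ∧ ∀ b, T (x * b) → x * b ∣ x := by
  by_contra! hc
  choose b hb hb' using fun x : {x // T x} => hc x.1 x.2
  let X : ℕ → {x // T x} := fun n => Nat.rec ⟨1, h1⟩ (fun _ x => ⟨x.1 * b x, hb x⟩) n
  have hX : ∀ n, ∏ i ∈ Finset.range n, b (X i) = (X n).1 := by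
    intro n
    induction n with
    | zero => simp [X]
    | succ n ih => rw [Finset.prod_range_succ, ih]
  obtain ⟨k, hk⟩ := h (fun n => b (X n))
  rw [hX, hX] at hk
  exact hb' (X k) hk

lemma DCCp.of_surj {S T : Type u} [CommRing S] [CommRing T] (h : DCCp S) (f : S →+* T)
    (hf : Surjective f) : DCCp T := by
  intro a
  choose b hb using fun n => hf (a n)
  obtain ⟨k, hk⟩ := h b
  refine ⟨k, ?_⟩
  simpa [map_prod, hb] using map_dvd f hk

lemma DCCp.exists_idem {S : Type u} [CommRing S] (h : DCCp S) (x : S) :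
    ∃ n y, x ^ n = x ^ (n + 1) * y := by
  obtain ⟨z, ⟨n, rfl⟩, hn⟩ := h.min (fun z => ∃ n, z = x ^ n) ⟨0, by simp⟩
  obtain ⟨y, hy⟩ := hn x ⟨n+1, by rw [pow_succ]⟩
  exact ⟨n, y, by rw [pow_succ]; exact hy⟩

lemma DCCp.dim0 {S : Type u} [CommRing S] (h : DCCp S) : Ring.KrullDimLE 0 S := by
  refine Ring.KrullDimLE.mk₀ fun P hP => ?_
  obtain ⟨Q, hQ, hPQ⟩ := P.exists_le_maximal hP.ne_top
  have : P = Q := by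
    refine le_antisymm hPQ fun x hx => ?_
    by_contra hxP
    obtain ⟨n, y, hy⟩ := h.exists_idem x
    have h0 : x ^ n * (1 - x * y) = 0 := by linear_combination hy
    have h1 : 1 - x * y ∈ P := (hP.mem_or_mem (h0 ▸ P.zero_mem : x ^ n * (1 - x*y) ∈ P)).resolve_left
      fun hh => hxP (hP.mem_of_pow_mem n hh)
    exact hQ.ne_top ((Ideal.eq_top_iff_one _).2 (by
      have := Q.add_mem (hPQ h1) (Q.mul_mem_right y hx)
      simpa using this))
  rwa [this]

lemma DCCp.finite {S : Type u} [CommRing S] (h : DCCp S) : Finite (PrimeSpectrum S) := by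
  by_contra hinf
  have hd := h.dim0
  obtain ⟨x, hx, hmin⟩ := h.min (fun x => {p : PrimeSpectrum S | x ∉ p.asIdeal}.Infinite) (by
    have : {p : PrimeSpectrum S | (1 : S) ∉ p.asIdeal} = Set.univ := by
      ext p; simpa using p.2.one_notMem
    rw [this]; exact Set.infinite_univ_iff.2 (not_finite_iff_infinite.1 hinf))
  obtain ⟨p, hp, q, hq, hpq⟩ := hx.nontrivial
  simp only [Set.mem_ofPred_eq] at hp hq
  -- separating idempotent
  have hnle : ¬ p.asIdeal ≤ q.asIdeal := by
    intro hle
    have : p.asIdeal.IsMaximal := Ideal.IsPrime.isMaximal' p.2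
    exact hpq (PrimeSpectrum.ext (this.eq_of_le q.2.ne_top hle))
  obtain ⟨z, hzp, hzq⟩ := SetLike.not_le_iff_exists.1 hnle
  have key : ∀ m, ∀ n y, z ^ n = z ^ (n+1) * y → z ^ n = z ^ (n + m) * y ^ m := by
    intro m n y hy
    induction m with
    | zero => simp
    | succ m ih =>
      calc z ^ n = z ^ (n+m) * y ^ m := ih
        _ = z ^ n * (z ^ m * y ^ m) := by ring
        _ = _ := by rw [hy]; ring
  obtain ⟨n, y, hy⟩ := h.exists_idem z
  have hk := key (n+1) n y hy
  set f := z ^ (n+1) * y ^ (n+1) with hf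
  have hzf : z ^ n * f = z ^ n := by rw [hf]; linear_combination -hk
  have hff : f * f = f := by
    conv_rhs => rw [hf, pow_succ, ← hzf]
    conv_lhs => enter [1]; rw [hf]
    ring
  have hfp : f ∈ p.asIdeal := by
    rw [hf, pow_succ]; exact Ideal.mul_mem_right _ _ (Ideal.mul_mem_left _ _ hzp)
  have hfq : f ∉ q.asIdeal := fun hh => hzq (q.2.mem_of_pow_mem n (hzf ▸ Ideal.mul_mem_left _ _ hh))
  have h1fq : 1 - f ∈ q.asIdeal := by
    refine (q.2.mem_or_mem (x := f) ?_).resolve_left hfq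
    rw [mul_sub, hff, mul_one, sub_self]; exact zero_mem _
  have hun : {p : PrimeSpectrum S | x ∉ p.asIdeal} ⊆
      {p : PrimeSpectrum S | x * f ∉ p.asIdeal} ∪ {p : PrimeSpectrum S | x * (1 - f) ∉ p.asIdeal} := by
    intro t ht
    by_contra hc
    simp only [Set.mem_union, Set.mem_ofPred_eq, not_or, not_not] at hc
    apply ht
    have := t.asIdeal.add_mem hc.1 hc.2
    rwa [← mul_add, add_sub_cancel, mul_one] at this
  rcases Set.infinite_union.1 (hx.mono hun) with hi | hi
  · exact hp (Ideal.mem_of_dvd _ (hmin _ hi) (Ideal.mul_mem_left _ _ hfp))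
  · exact hq (Ideal.mem_of_dvd _ (hmin _ hi) (Ideal.mul_mem_left _ _ h1fq))

open IsLocalRing in
lemma DCCp.nakayama {S : Type u} [CommRing S] [IsLocalRing S] (h : DCCp S) {M : Type u}
    [AddCommGroup M] [Module S M] (hM : maximalIdeal S • (⊤ : Submodule S M) = ⊤) :
    Subsingleton M := by
  by_contra hns
  rw [not_subsingleton_iff_nontrivial] at hns
  obtain ⟨x, hx, hmin⟩ := h.min (fun x => ∃ m : M, x • m ≠ 0) (by
    obtain ⟨m, hm⟩ := exists_ne (0 : M); exact ⟨m, by simpa⟩)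
  have : ∃ a ∈ maximalIdeal S, ∃ m : M, (x * a) • m ≠ 0 := by
    by_contra! hc
    obtain ⟨m, hm⟩ := hx
    apply hm
    have hm' : m ∈ maximalIdeal S • (⊤ : Submodule S M) := by rw [hM]; trivial
    induction hm' using Submodule.smul_induction_on' with
    | smul a ha n hn => rw [smul_smul]; exact hc a ha n
    | add a _ b _ iha ihb =>
      rw [smul_add]
      by_cases h1 : x • a = 0 <;> by_cases h2 : x • b = 0 <;> simp_all
  obtain ⟨a, ha, hm⟩ := this
  obtain ⟨y, hy⟩ := hmin a hm
  have hu : IsUnit (1 - a * y) := by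
    by_contra hu
    have := (maximalIdeal S).add_mem ((mem_maximalIdeal _).2 hu) (Ideal.mul_mem_right y _ ha)
    simp at this
  have : x = 0 := hu.mul_left_eq_zero.1 (by linear_combination hy)
  obtain ⟨m, hm⟩ := hx
  exact hm (by simp [this])

open IsLocalRing TensorProduct in
lemma DCCp.free_local {S : Type u} [CommRing S] [IsLocalRing S] (h : DCCp S) {M : Type u}
    [AddCommGroup M] [Module S M] [Module.Flat S M] : Module.Free S M := by
  let k := ResidueField S
  let w := Module.Free.chooseBasis k (k ⊗[S] M)
  obtain ⟨v, eq⟩ := (TensorProduct.mk_surjective S M k Ideal.Quotient.mk_surjective).comp_left w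
  have hli : LinearIndependent k (TensorProduct.mk S k M 1 ∘ v) := by
    have eq' : TensorProduct.mk S k M 1 ∘ v = w := eq
    rw [eq']; exact w.linearIndependent
  refine .of_basis <| .mk (v := v) (Module.IsLocalRing.linearIndependent_of_flat _ hli) ?_
  set N := Submodule.span S (Set.range v) with hN
  have h1 : N.map (TensorProduct.mk S k M 1) = ⊤ := by
    rw [hN, Submodule.map_span, ← Submodule.restrictScalars_span S k
      Ideal.Quotient.mk_surjective, Submodule.restrictScalars_eq_top_iff,
      ← w.span_eq, ← Set.range_comp]
    exact congrArg (fun f => Submodule.span k (Set.range f)) eq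
  have h2 : Subsingleton (M ⧸ N) := by
    apply h.nakayama
    have h3 : Subsingleton (k ⊗[S] (M ⧸ N)) := by
      refine subsingleton_of_forall_eq 0 fun t => ?_
      obtain ⟨t, rfl⟩ := LinearMap.lTensor_surjective k N.mkQ_surjective t
      obtain ⟨n, hn, rfl⟩ : t ∈ N.map (TensorProduct.mk S k M 1) := h1 ▸ trivial
      simp [(Submodule.Quotient.mk_eq_zero N).2 hn]
    have h4 : Subsingleton ((M ⧸ N) ⧸ (maximalIdeal S • (⊤ : Submodule S (M ⧸ N)))) :=
      have h3 : Subsingleton ((S ⧸ maximalIdeal S) ⊗[S] (M ⧸ N)) := h3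
      (TensorProduct.quotTensorEquivQuotSMul (M ⧸ N) (maximalIdeal S)).symm.injective.subsingleton
    exact Submodule.Quotient.subsingleton_iff.1 h4
  exact (Submodule.Quotient.subsingleton_iff.1 h2).ge

open TensorProduct in
lemma DCCp.projective {S : Type u} [CommRing S] (h : DCCp S) {M : Type u}
    [AddCommGroup M] [Module S M] [Module.Flat S M] : Module.Projective S M := by
  classical
  have := h.finite
  have := h.dim0
  have : DiscreteTopology (PrimeSpectrum S) :=
    PrimeSpectrum.discreteTopology_iff_finite_and_krullDimLE_zero.2 ⟨h.finite, h.dim0⟩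
  have : Fintype (PrimeSpectrum S) := Fintype.ofFinite _
  let L : PrimeSpectrum S → Type u := fun p => Localization.AtPrime p.asIdeal
  have hb : Bijective (PrimeSpectrum.toPiLocalization S) := PrimeSpectrum.toPiLocalization_bijective
  let e : S ≃ₗ[S] (∀ p, L p) := LinearEquiv.ofBijective (PrimeSpectrum.toPiLocalization S).toLinearMap hb
  have hL : ∀ p, Module.Projective S (L p) := fun p =>
    Module.Projective.of_split (M := S) (e.symm.toLinearMap ∘ₗ LinearMap.single S L p)
      (LinearMap.proj p ∘ₗ e.toLinearMap) (by ext; simp)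
  have hs : ∀ p, Surjective (algebraMap S (L p)) := fun p y => by
    obtain ⟨s, hs⟩ := hb.2 (Pi.single p y)
    exact ⟨s, (congrFun hs p).trans (Pi.single_eq_same p y)⟩
  have hP : ∀ p, Module.Projective S (L p ⊗[S] M) := fun p => by
    have hD : DCCp (L p) := h.of_surj _ (hs p)
    have : IsLocalRing (L p) := inferInstanceAs (IsLocalRing (Localization.AtPrime p.asIdeal))
    have : Module.Free (L p) (L p ⊗[S] M) := hD.free_local
    have : Module.Projective S (Module.Free.ChooseBasisIndex (L p) (L p ⊗[S] M) →₀ L p) :=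
      Module.Projective.of_equiv (finsuppLequivDFinsupp (ι := Module.Free.ChooseBasisIndex (L p) (L p ⊗[S] M)) (M := L p) S).symm
    exact Module.Projective.of_equiv ((Module.Free.chooseBasis (L p) (L p ⊗[S] M)).repr.restrictScalars S).symm
  have hP' : ∀ p, Module.Projective S (M ⊗[S] L p) := fun p =>
    Module.Projective.of_equiv (TensorProduct.comm S (L p) M)
  let E : M ≃ₗ[S] (∀ p, M ⊗[S] L p) :=
    (TensorProduct.rid S M).symm ≪≫ₗ (LinearEquiv.lTensor M e) ≪≫ₗ TensorProduct.piRight S S M L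
  have : Module.Projective S (∀ p, M ⊗[S] L p) :=
    Module.Projective.of_equiv (DFinsupp.linearEquivFunOnFintype (R := S) (M := fun p => M ⊗[S] L p))
  exact Module.Projective.of_equiv E.symm

lemma schanuel_aux {R : Type u} [CommRing R] {F B : Type u} [AddCommGroup F] [Module R F]
    [AddCommGroup B] [Module R B] [Module.Projective R F] (π : F →ₗ[R] B) (hπ : Surjective π)
    (h : ProjDimLE1 R B) : Module.Projective R (LinearMap.ker π) := by
  obtain ⟨P, g, hP, hg, hK⟩ := h
  obtain ⟨α, hα⟩ := Module.projective_lifting_property π g hπ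
  obtain ⟨β, hβ⟩ := Module.projective_lifting_property g π hg
  have hα' : ∀ x, π (α x) = g x := fun x => LinearMap.congr_fun hα x
  have hβ' : ∀ x, g (β x) = π x := fun x => LinearMap.congr_fun hβ x
  refine Module.Projective.of_split (M := F × LinearMap.ker g)
    ((LinearMap.ker π).subtype.prod
      (LinearMap.codRestrict (LinearMap.ker g) (-(β ∘ₗ (LinearMap.ker π).subtype))
        (fun x => by simp [hβ'])))
    (LinearMap.codRestrict (LinearMap.ker π)
      (LinearMap.coprod (LinearMap.id - α ∘ₗ β) (-(α ∘ₗ (LinearMap.ker g).subtype)))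
        (fun x => by simp [hα', hβ'])) ?_
  refine LinearMap.ext fun x => Subtype.ext ?_
  change ((x : F) - α (β x)) + -(α (-(β x))) = x
  simp

lemma pd_quot {R : Type u} [CommRing R] (r : R) (hreg : r ∈ nonZeroDivisors R) :
    ProjDimLE1 R (R ⧸ Ideal.span {r}) := by
  refine ⟨ModuleCat.of R R, (Submodule.mkQ (Ideal.span {r}) : R →ₗ[R] _), ?_, ?_, ?_⟩
  · exact inferInstanceAs (Module.Projective R R)
  · exact Submodule.mkQ_surjective _
  · have : Module.Projective R (LinearMap.range (LinearMap.toSpanSingleton R R r)) := by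
      refine Module.Projective.of_equiv (LinearEquiv.ofInjective (LinearMap.toSpanSingleton R R r) ?_)
      intro x y hxy
      exact (mul_cancel_right_mem_nonZeroDivisors hreg).1 (by simpa using hxy)
    refine Module.Projective.of_equiv (LinearEquiv.ofEq _ _ ?_) (M := LinearMap.range (LinearMap.toSpanSingleton R R r))
    rw [Submodule.ker_mkQ, LinearMap.range_toSpanSingleton]

section bass
variable {R : Type u} [CommRing R] (b : ℕ → R) (r : R)

noncomputable def bd : (ℕ →₀ R) →ₗ[R] (ℕ →₀ R) :=
  Finsupp.linearCombination R (fun n => Finsupp.single n 1 - Finsupp.single (n+1) (b n))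

noncomputable def bD : ((ℕ →₀ R) × (ℕ →₀ R)) →ₗ[R] (ℕ →₀ R) :=
  (bd b).coprod (r • LinearMap.id)

lemma bd_single (n : ℕ) (x : R) : bd b (Finsupp.single n x) =
    Finsupp.single n x - Finsupp.single (n+1) (x * b n) := by
  simp [bd, smul_sub]

lemma bd_zero (u : ℕ →₀ R) : bd b u 0 = u 0 := by
  induction u using Finsupp.induction_linear with
  | zero => simp
  | add f g hf hg => simp [hf, hg]
  | single n x => simp [bd_single]

lemma bd_succ (u : ℕ →₀ R) (m : ℕ) : bd b u (m+1) = u (m+1) - b m * u m := by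
  induction u using Finsupp.induction_linear with
  | zero => simp
  | add f g hf hg => simp [hf, hg]; ring
  | single n x =>
    simp only [bd_single, Finsupp.sub_apply, Finsupp.single_apply, add_left_inj]
    by_cases h : n = m
    · subst h; simp [mul_comm]
    · simp [h]

lemma bker (u v : ℕ →₀ R) (h : bD b r (u, v) = 0) : ∃ u', u = r • u' := by
  have h' : ∀ n, bd b u n + r * v n = 0 := fun n => by
    simpa [bD] using DFunLike.congr_fun h n
  have hd : ∀ n, r ∣ u n := by
    intro n
    induction n with
    | zero => exact ⟨- v 0, by have := h' 0; rw [bd_zero] at this; linear_combination this⟩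
    | succ n ih =>
      obtain ⟨c, hc⟩ := ih
      refine ⟨b n * c - v (n+1), ?_⟩
      have := h' (n+1)
      rw [bd_succ] at this
      linear_combination this + b n * hc
  choose c hc using hd
  refine ⟨∑ n ∈ u.support, Finsupp.single n (c n), ?_⟩
  rw [Finset.smul_sum]
  conv_lhs => rw [← Finsupp.sum_single u]
  refine Finset.sum_congr rfl fun n _ => ?_
  rw [Finsupp.smul_single, smul_eq_mul, ← hc]

lemma dcc_of_proj (hreg : r ∈ nonZeroDivisors R)
    (hP : Module.Projective R (LinearMap.range (bD b r))) :
    ∃ k, (∏ i ∈ Finset.range (k+1), Ideal.Quotient.mk (Ideal.span {r}) (b i)) ∣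
      ∏ i ∈ Finset.range k, Ideal.Quotient.mk (Ideal.span {r}) (b i) := by
  obtain ⟨σ, hσ⟩ := Module.projective_lifting_property (bD b r).rangeRestrict LinearMap.id
    (LinearMap.surjective_rangeRestrict _)
  have hσ' : ∀ x, bD b r (σ x) = x := fun x => congrArg Subtype.val (LinearMap.congr_fun hσ x)
  let ρ : ((ℕ →₀ R) × (ℕ →₀ R)) →ₗ[R] ((ℕ →₀ R) × (ℕ →₀ R)) :=
    LinearMap.id - σ ∘ₗ (bD b r).rangeRestrict
  have hρ : ∀ w, bD b r (ρ w) = 0 := fun w => by simp [ρ, hσ']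
  have hρ' : ∀ w, bD b r w = 0 → ρ w = w := fun w hw => by
    have : (bD b r).rangeRestrict w = 0 := Subtype.ext hw
    simp [ρ, this]
  choose q hq using fun w => bker b r (ρ w).1 (ρ w).2 (hρ w)
  set y : ℕ → ℕ →₀ R := fun n => q (0, Finsupp.single n 1) with hy
  set z : ℕ → ℕ →₀ R := fun n => q (Finsupp.single n 1, 0) with hz
  have key : ∀ n, Finsupp.single n 1 = r • z n - y n + b n • y (n+1) := by
    intro n
    have h1 := hρ' (r • (Finsupp.single n 1, 0) - (0, Finsupp.single n 1)
      + b n • (0, Finsupp.single (n+1) 1)) (by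
        simp [bD, bd_single])
    have h2 := congrArg Prod.fst h1
    simp only [map_add, map_sub, map_smul, Prod.fst_add, Prod.fst_sub, Prod.smul_fst, hq] at h2
    have h3 : r • (r • z n - y n + b n • y (n+1)) = r • Finsupp.single n 1 := by
      rw [smul_add, smul_sub, smul_comm r (b n)]
      simpa using h2
    ext i
    have h4 := DFunLike.congr_fun h3 i
    simp only [Finsupp.smul_apply, smul_eq_mul] at h4
    exact ((mul_cancel_left_mem_nonZeroDivisors hreg).1 h4).symm
  obtain ⟨k, hk⟩ := Infinite.exists_notMem_finset (y 0).support
  rw [Finsupp.notMem_support_iff] at hk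
  let Q := Ideal.Quotient.mk (Ideal.span {r})
  have hr : Q r = 0 := Ideal.Quotient.eq_zero_iff_mem.2 (Ideal.mem_span_singleton_self r)
  have key2 : ∀ n, Q (Finsupp.single n 1 k) = - Q (y n k) + Q (b n) * Q (y (n+1) k) := by
    intro n
    have := congrArg Q (DFunLike.congr_fun (key n) k)
    simpa [hr] using this
  have key3 : ∀ n ≤ k, Q (y 0 k) = (∏ i ∈ Finset.range n, Q (b i)) * Q (y n k) := by
    intro n hn
    induction n with
    | zero => simp
    | succ n ih =>
      have h1 := key2 n
      rw [Finsupp.single_eq_of_ne (by omega), map_zero] at h1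
      rw [ih (by omega), Finset.prod_range_succ]
      linear_combination (∏ i ∈ Finset.range n, Q (b i)) * h1
  have h1 := key2 k
  have h2 := key3 k le_rfl
  rw [hk, map_zero] at h2
  rw [Finsupp.single_eq_same, map_one] at h1
  refine ⟨k, Q (y (k+1) k), ?_⟩
  rw [Finset.prod_range_succ]
  linear_combination (∏ i ∈ Finset.range k, Q (b i)) * h1 + h2

noncomputable def bφ (N : ℕ) : (ℕ →₀ R) →ₗ[R] R :=
  Finsupp.linearCombination R (fun i => ∏ l ∈ Finset.Ico i N, b l)

lemma bφ_d (N : ℕ) (u : ℕ →₀ R) (hu : ∀ n ∈ u.support, n < N) : bφ b N (bd b u) = 0 := by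
  rw [bd, Finsupp.linearCombination_apply, Finsupp.sum, map_sum]
  refine Finset.sum_eq_zero fun n hn => ?_
  rw [map_smul, map_sub, bφ]
  simp only [Finsupp.linearCombination_single, smul_eq_mul, one_mul]
  rw [Finset.prod_eq_prod_Ico_succ_bot (hu n hn), sub_self, mul_zero]

lemma bq_step (i j : ℕ) (hij : i ≤ j) (x : R) :
    (LinearMap.range (bD b r)).mkQ (Finsupp.single j (x * ∏ l ∈ Finset.Ico i j, b l)) =
    (LinearMap.range (bD b r)).mkQ (Finsupp.single i x) := by
  induction j, hij using Nat.le_induction with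
  | base => simp
  | succ j hij ih =>
    rw [← ih, Finset.prod_Ico_succ_top hij, eq_comm, ← sub_eq_zero, ← map_sub]
    rw [Submodule.mkQ_apply, Submodule.Quotient.mk_eq_zero]
    exact ⟨(Finsupp.single j (x * ∏ l ∈ Finset.Ico i j, b l), 0), by
      rw [← mul_assoc]; simp only [bD, LinearMap.coprod_apply, bd_single, map_zero, add_zero]⟩

noncomputable def bg (i : ℕ) : (R ⧸ Ideal.span {r}) →ₗ[R] ((ℕ →₀ R) ⧸ LinearMap.range (bD b r)) :=
  Submodule.liftQ (Ideal.span {r}) ((LinearMap.range (bD b r)).mkQ ∘ₗ Finsupp.lsingle i) (by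
    rw [Ideal.span, Submodule.span_le, Set.singleton_subset_iff]
    simp only [SetLike.mem_coe, LinearMap.mem_ker, LinearMap.comp_apply, Submodule.mkQ_apply,
      Submodule.Quotient.mk_eq_zero]
    exact ⟨(0, Finsupp.single i 1), by simp [bD]⟩)

lemma bg_mk (i : ℕ) (x : R) : bg b r i (Ideal.Quotient.mk _ x) =
    (LinearMap.range (bD b r)).mkQ (Finsupp.single i x) := rfl

lemma bass_limit (hreg : r ∈ nonZeroDivisors R) :
    IsDirectLimitOf R (P1Class R) ((ℕ →₀ R) ⧸ LinearMap.range (bD b r)) := by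
  refine ⟨ULift.{u} ℕ, fun i j => i.down ≤ j.down, fun i j k => le_trans, inferInstance,
    fun i => le_rfl, fun i j => ⟨⟨max i.down j.down⟩, le_max_left _ _, le_max_right _ _⟩,
    fun _ => ModuleCat.of R (R ⧸ Ideal.span {r}),
    fun i j _ => (∏ l ∈ Finset.Ico i.down j.down, b l) •
      (LinearMap.id : (R ⧸ Ideal.span {r}) →ₗ[R] (R ⧸ Ideal.span {r})),
    fun i => bg b r i.down, fun _ => pd_quot r hreg, ?_, ?_, ?_, ?_, ?_⟩
  · intro i h; simp
  · intro i j k hij hjk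
    ext
    simp [smul_smul, ← Finset.prod_Ico_consecutive b hij hjk, mul_comm]
  · intro i j hij
    refine LinearMap.ext fun x => ?_
    obtain ⟨x, rfl⟩ := Ideal.Quotient.mk_surjective x
    change bg b r j.down ((∏ l ∈ Finset.Ico i.down j.down, b l) • Ideal.Quotient.mk _ x) = _
    rw [map_smul, bg_mk, bg_mk, ← map_smul, ← bq_step b r i.down j.down hij, Finsupp.smul_single,
      smul_eq_mul, mul_comm]
  · intro m
    obtain ⟨u, rfl⟩ := Submodule.mkQ_surjective _ m
    suffices ∃ i x, (LinearMap.range (bD b r)).mkQ (Finsupp.single i x) =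
        (LinearMap.range (bD b r)).mkQ u by
      obtain ⟨i, x, h⟩ := this
      exact ⟨⟨i⟩, Ideal.Quotient.mk _ x, h⟩
    induction u using Finsupp.induction_linear with
    | zero => exact ⟨0, 0, by simp⟩
    | single i x => exact ⟨i, x, rfl⟩
    | add f g hf hg =>
      obtain ⟨i, x, hi⟩ := hf
      obtain ⟨j, y, hj⟩ := hg
      rw [map_add, ← hi, ← hj, ← bq_step b r i (max i j) (le_max_left _ _),
        ← bq_step b r j (max i j) (le_max_right _ _), ← map_add, ← Finsupp.single_add]
      exact ⟨_, _, rfl⟩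
  · intro i x hx
    obtain ⟨x, rfl⟩ := Ideal.Quotient.mk_surjective x
    replace hx : (LinearMap.range (bD b r)).mkQ (Finsupp.single i.down x) = 0 := hx
    rw [Submodule.mkQ_apply, Submodule.Quotient.mk_eq_zero] at hx
    obtain ⟨⟨u, v⟩, huv⟩ := hx
    let N := max i.down (u.support.sup id + 1)
    refine ⟨⟨N⟩, le_max_left _ _, ?_⟩
    change (∏ l ∈ Finset.Ico i.down N, b l) • Ideal.Quotient.mk (Ideal.span {r}) x = 0
    have h1 := congrArg (bφ b N) huv
    have h2 : bφ b N (bd b u) = 0 := bφ_d b N u fun n hn => by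
      have : id n ≤ u.support.sup id := Finset.le_sup hn
      simp only [id] at this
      omega
    simp only [bD, LinearMap.coprod_apply, map_add, h2, zero_add, LinearMap.smul_apply, map_smul,
      LinearMap.id_apply, smul_eq_mul] at h1
    have h3 : bφ b N (Finsupp.single i.down x) = (∏ l ∈ Finset.Ico i.down N, b l) * x := by
      simp [bφ, mul_comm]
    have h4 : (∏ l ∈ Finset.Ico i.down N, b l) • Ideal.Quotient.mk (Ideal.span {r}) x =
      Ideal.Quotient.mk (Ideal.span {r}) ((∏ l ∈ Finset.Ico i.down N, b l) * x) := rfl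
    rw [h4, Ideal.Quotient.eq_zero_iff_mem, ← h3, ← h1]
    exact Ideal.mul_mem_right _ _ (Ideal.mem_span_singleton_self r)

end bass

lemma dcc_main (R : Type u) [CommRing R]
    (hclosed : ∀ M : ModuleCat.{u} R,
      IsDirectLimitOf R (P1Class R) (M : Type u) → ProjDimLE1 R (M : Type u))
    (r : R) (hreg : r ∈ nonZeroDivisors R) : DCCp (R ⧸ Ideal.span {r}) := by
  intro a
  choose b hb using fun n => Ideal.Quotient.mk_surjective (a n)
  have h1 := hclosed (ModuleCat.of R ((ℕ →₀ R) ⧸ LinearMap.range (bD b r))) (bass_limit b r hreg)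
  have h2 := schanuel_aux (LinearMap.range (bD b r)).mkQ (Submodule.mkQ_surjective _) h1
  rw [Submodule.ker_mkQ] at h2
  simpa [hb] using dcc_of_proj b r hreg h2

/-- **Proposition 3.6 ((ii) ⇒ (iii)).** Let `R` be a commutative ring. If the class
`𝒫₁(R)` is closed under direct limits, then for every regular non-unit `r ∈ R` the
quotient ring `R/rR` is perfect, i.e. every flat `R/rR`-module is projective. -/
theorem quotient_perfect_of_P1_closed_under_direct_limits (R : Type u) [CommRing R]
    (hclosed : ∀ M : ModuleCat.{u} R,
      IsDirectLimitOf R (P1Class R) (M : Type u) → ProjDimLE1 R (M : Type u))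
    (r : R) (hreg : r ∈ nonZeroDivisors R) (hnonunit : ¬IsUnit r) :
    ∀ (F : Type u) [AddCommGroup F] [Module (R ⧸ Ideal.span {r}) F],
      Module.Flat (R ⧸ Ideal.span {r}) F → Module.Projective (R ⧸ Ideal.span {r}) F := by
  intro F _ _ hF
  exact (dcc_main R hclosed r hreg).projective
end

section
/- Let R be a commutative ring with total ring of quotients Q, and suppose the class 𝒫₁(R) is covering in Mod-R. Then a Q-module M has projective dimension at most 1 over Q if and only if M, viewed as an R-module by restriction along R → Q, has projective dimension at most 1 over R; that is, 𝒫₁(R) ∩ Mod-Q = 𝒫₁(Q). -/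
universe u

open MulOpposite Function

/-- `φ : P → M` is a `C`-cover of `M`: `P ∈ C`, every map from a module of `C` to `M`
factors through `φ`, and every endomorphism `e` of `P` with `φ ∘ e = φ` is an automorphism. -/
def IsCover (A : Type u) [Ring A] (C : Set (ModuleCat.{u} A)) (P : ModuleCat.{u} A)
    (M : Type u) [AddCommGroup M] [Module A M] (φ : P →ₗ[A] M) : Prop :=
  P ∈ C ∧
  (∀ P' ∈ C, ∀ ψ : (P' : Type u) →ₗ[A] M, ∃ h : (P' : Type u) →ₗ[A] (P : Type u),
    φ.comp h = ψ) ∧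
  (∀ e : (P : Type u) →ₗ[A] (P : Type u), φ.comp e = φ → Function.Bijective e)

/-- The class `C` is covering: every `A`-module admits a `C`-cover. -/
def IsCoveringClass (A : Type u) [Ring A] (C : Set (ModuleCat.{u} A)) : Prop :=
  ∀ M : ModuleCat.{u} A, ∃ (P : ModuleCat.{u} A) (φ : P →ₗ[A] (M : Type u)),
    IsCover A C P (M : Type u) φ

section helpers

theorem proj_ker_of_retract {A : Type*} [Ring A] {F M P C : Type*}
    [AddCommGroup F] [Module A F] [AddCommGroup M] [Module A M]
    [AddCommGroup P] [Module A P] [AddCommGroup C] [Module A C]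
    [Module.Projective A F] [Module.Projective A P]
    (p : F →ₗ[A] M) (hp : Function.Surjective p)
    (g : P →ₗ[A] C) (hg : Function.Surjective g) [Module.Projective A (LinearMap.ker g)]
    (s : M →ₗ[A] C) (t : C →ₗ[A] M) (hts : ∀ m, t (s m) = m) :
    Module.Projective A (LinearMap.ker p) := by
  obtain ⟨a, ha⟩ := Module.projective_lifting_property g (s ∘ₗ p) hg
  obtain ⟨b, hb⟩ := Module.projective_lifting_property p (t ∘ₗ g) hp
  have ha' : ∀ x, g (a x) = s (p x) := fun x => LinearMap.congr_fun ha x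
  have hb' : ∀ x, p (b x) = t (g x) := fun x => LinearMap.congr_fun hb x
  let i : LinearMap.ker p →ₗ[A] LinearMap.ker g × F :=
    LinearMap.prod ((a ∘ₗ (LinearMap.ker p).subtype).codRestrict _ (by
      rintro ⟨x, hx⟩
      have hx : p x = 0 := hx
      simp [ha', hx])) (LinearMap.ker p).subtype
  let r : LinearMap.ker g × F →ₗ[A] LinearMap.ker p :=
    (b ∘ₗ (LinearMap.ker g).subtype ∘ₗ LinearMap.fst A _ _ +
      (LinearMap.id - b ∘ₗ a) ∘ₗ LinearMap.snd A _ _).codRestrict _ (by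
      rintro ⟨⟨k, hk⟩, x⟩
      have hk : g k = 0 := hk
      simp [hb', ha', hts, hk])
  refine Module.Projective.of_split i r ?_
  ext ⟨x, hx⟩
  simp [i, r]

theorem ProjDimLE1.retract {A : Type u} [Ring A] {M C : Type u}
    [AddCommGroup M] [Module A M] [AddCommGroup C] [Module A C] (h : ProjDimLE1 A C)
    (s : M →ₗ[A] C) (t : C →ₗ[A] M) (hts : ∀ m, t (s m) = m) : ProjDimLE1 A M := by
  obtain ⟨P, g, h1, h2, h3⟩ := h
  have hs : Function.Surjective (Finsupp.linearCombination A (id : M → M)) :=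
    Finsupp.linearCombination_id_surjective A M
  exact ⟨ModuleCat.of A (M →₀ A), Finsupp.linearCombination A id,
    inferInstanceAs (Module.Projective A (M →₀ A)), hs,
    proj_ker_of_retract _ hs g h2 s t hts⟩

open TensorProduct in
theorem ProjDimLE1.localize (R : Type u) [CommRing R] (Q : Type u) [CommRing Q]
    [Algebra R Q] [IsFractionRing R Q]
    (M : Type u) [AddCommGroup M] [Module R M] [Module Q M] [IsScalarTower R Q M]
    (h : ProjDimLE1 R M) : ProjDimLE1 Q M := by
  obtain ⟨P, g, h1, h2, h3⟩ := h
  have := isLocalizedModule_id (nonZeroDivisors R) M Q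
  have hb : IsBaseChange Q (LinearMap.id : M →ₗ[R] M) :=
    IsLocalizedModule.isBaseChange (nonZeroDivisors R) Q _
  have hflat : Module.Flat R Q := IsLocalization.flat Q (nonZeroDivisors R)
  have hk : Module.Projective Q (LinearMap.ker (AlgebraTensorModule.lTensor Q Q g)) :=
    Module.Projective.of_equiv (LinearMap.tensorKerEquiv Q Q g)
  have : ProjDimLE1 Q (Q ⊗[R] M) := by
    refine ⟨ModuleCat.of Q (Q ⊗[R] P), AlgebraTensorModule.lTensor Q Q g, ?_, ?_, hk⟩
    · exact inferInstanceAs (Module.Projective Q (Q ⊗[R] P))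
    · exact LinearMap.lTensor_surjective Q h2
  exact this.retract hb.equiv.symm.toLinearMap hb.equiv.toLinearMap (by simp)

theorem linInd_coe {A G I : Type*} [Ring A] [AddCommGroup G] [Module A G] (K : Submodule A G)
    (b : Module.Basis I A K) : LinearIndependent A (fun a => (b a : G)) :=
  b.linearIndependent.map' K.subtype (Submodule.ker_subtype _)

theorem exists_model (R : Type u) [CommRing R] (Q : Type u) [CommRing Q]
    [Algebra R Q] [IsFractionRing R Q] (B : Type u)
    (X : Type u) [AddCommGroup X] [Module R X] [Module Q X] [IsScalarTower R Q X]
    (p : (B →₀ Q) →ₗ[Q] X) (hp : Function.Surjective p) [Module.Free Q (LinearMap.ker p)] :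
    ∃ (N : ModuleCat.{u} R) (f : N →ₗ[R] X), ProjDimLE1 R N ∧
      ∀ (C : Type u) [AddCommGroup C] [Module R C],
        (∀ x : nonZeroDivisors R, IsUnit ((algebraMap R (Module.End R C)) x)) →
        (∀ h : N →ₗ[R] C, ∃ k : X →ₗ[R] C, k ∘ₗ f = h) ∧
        (∀ k k' : X →ₗ[R] C, k ∘ₗ f = k' ∘ₗ f → k = k') := by
  let i : (B →₀ R) →ₗ[R] (B →₀ Q) := Finsupp.mapRange.linearMap (Algebra.linearMap R Q)
  have hi : IsLocalizedModule (nonZeroDivisors R) i := inferInstance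
  obtain ⟨⟨I, b⟩⟩ := Module.Free.exists_basis Q (LinearMap.ker p)
  choose sec hsec using fun a => IsLocalizedModule.surj (nonZeroDivisors R) i (b a : B →₀ Q)
  let v := fun a => (sec a).1
  have hv : ∀ a, i (v a) = ((sec a).2 : R) • (b a : B →₀ Q) := fun a => (hsec a).symm
  let V := Submodule.span R (Set.range v)
  have hli : LinearIndependent R v := by
    have h1 : LinearIndependent Q (fun a => (b a : B →₀ Q)) :=
      linInd_coe _ b
    have h2 := h1.units_smul (fun a => (IsLocalization.map_units Q (sec a).2).unit)
    have hiv : (i ∘ v) = (fun a => (IsLocalization.map_units Q (sec a).2).unit) •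
        (fun a => (b a : B →₀ Q)) := by
      funext a
      rw [Function.comp_apply, hv, Pi.smul_apply', Units.smul_def, IsUnit.unit_spec,
        algebraMap_smul]
    rw [← hiv] at h2
    have hQ : Function.Injective fun r : R => r • (1 : Q) := by
      intro x y hxy
      exact IsFractionRing.injective R Q (by simpa [Algebra.smul_def] using hxy)
    have h3 : LinearIndependent R (i ∘ v) := h2.restrict_scalars hQ
    exact LinearIndependent.of_comp i h3
  have hV : Module.Projective R V := Module.Projective.of_basis (Module.Basis.span hli)
  have hpi : V ≤ LinearMap.ker ((p.restrictScalars R) ∘ₗ i) := by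
    rw [Submodule.span_le]
    rintro _ ⟨a, rfl⟩
    have : p (b a : B →₀ Q) = 0 := (b a).2
    simp [hv, this]
  refine ⟨ModuleCat.of R ((B →₀ R) ⧸ V), V.liftQ _ hpi, ?_, ?_⟩
  · refine ⟨ModuleCat.of R (B →₀ R), V.mkQ, inferInstanceAs (Module.Projective R (B →₀ R)),
      V.mkQ_surjective, ?_⟩
    rw [Submodule.ker_mkQ]
    exact hV
  · intro C _ _ hC
    constructor
    · intro h
      let h0 : (B →₀ R) →ₗ[R] C := LinearMap.comp h V.mkQ
      let k0 := IsLocalizedModule.lift (nonZeroDivisors R) i h0 hC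
      have hk0 : ∀ y, k0 (i y) = h0 y := IsLocalizedModule.lift_apply _ i h0 hC
      have hinj : ∀ (s : nonZeroDivisors R) (c : C), (s : R) • c = 0 → c = 0 := by
        intro s c hc
        have := ((Module.End.isUnit_iff _).1 (hC s)).1
        exact this (by simpa using hc)
      have hker : LinearMap.ker (p.restrictScalars R) ≤ LinearMap.ker k0 := by
        have h1 : ∀ (q : Q) a, k0 (q • (b a : B →₀ Q)) = 0 := by
          intro q a
          obtain ⟨⟨r, t⟩, hrt⟩ := IsLocalization.surj (nonZeroDivisors R) q
          apply hinj ((sec a).2 * t)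
          rw [← map_smul]
          have : (((sec a).2 * t : nonZeroDivisors R) : R) • q • (b a : B →₀ Q)
              = i (r • v a) := by
            rw [map_smul, hv, ← algebraMap_smul Q, ← algebraMap_smul Q r,
              ← algebraMap_smul Q ((sec a).2 : R), smul_smul, smul_smul, ← hrt]
            congr 1
            simp
            ring
          rw [this, hk0]
          have : V.mkQ (v a) = 0 := by
            have hm : v a ∈ V := Submodule.subset_span (Set.mem_range_self a)
            exact (Submodule.Quotient.mk_eq_zero V).2 hm
          simp only [h0, LinearMap.comp_apply, map_smul, this]
          simp
        intro x hx
        have hx' : x ∈ LinearMap.ker p := hx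
        have h2 := b.linearCombination_repr ⟨x, hx'⟩
        have h3 := congrArg (Subtype.val) h2
        simp only [Finsupp.linearCombination_apply, Finsupp.sum] at h3
        rw [Submodule.coe_sum] at h3
        rw [LinearMap.mem_ker, ← h3, map_sum]
        exact Finset.sum_eq_zero fun a _ => h1 _ a
      have hps : Function.Surjective (p.restrictScalars R) := hp
      let e := (p.restrictScalars R).quotKerEquivOfSurjective hps
      refine ⟨(LinearMap.ker (p.restrictScalars R)).liftQ k0 hker ∘ₗ e.symm.toLinearMap, ?_⟩
      refine LinearMap.ext fun n => ?_
      obtain ⟨y, rfl⟩ := V.mkQ_surjective n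
      have : e.symm (p (i y)) = Submodule.Quotient.mk (i y) := by
        rw [LinearEquiv.symm_apply_eq]; rfl
      change (LinearMap.ker (p.restrictScalars R)).liftQ k0 hker (e.symm (p (i y))) = _
      rw [this]
      exact hk0 y
    · intro k k' hkk
      have h1 : k ∘ₗ p.restrictScalars R = k' ∘ₗ p.restrictScalars R := by
        apply IsLocalizedModule.ext (nonZeroDivisors R) i hC
        ext1 y
        ext
        exact LinearMap.congr_fun hkk (V.mkQ (Finsupp.single y 1))
      ext x
      obtain ⟨y, rfl⟩ := hp x
      exact LinearMap.congr_fun h1 y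

theorem cover_units (R : Type u) [CommRing R] (P : ModuleCat.{u} R)
    (M : Type u) [AddCommGroup M] [Module R M] (T : Set (ModuleCat.{u} R)) (f : P →ₗ[R] M)
    (h : IsCover R T P M f) (r : R) (hr : IsUnit ((algebraMap R (Module.End R M)) r)) :
    IsUnit ((algebraMap R (Module.End R P)) r) := by
  obtain ⟨h1, h2, h3⟩ := h
  obtain ⟨u, hu⟩ := hr
  have hur : ∀ m, (u : Module.End R M) m = r • m := fun m => by rw [hu]; rfl
  obtain ⟨g, hg⟩ := h2 P h1 ((↑u⁻¹ : Module.End R M) ∘ₗ f)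
  have hg' : ∀ x, f (g x) = (↑u⁻¹ : Module.End R M) (f x) := fun x => LinearMap.congr_fun hg x
  have key : ∀ x, f (r • g x) = f x := by
    intro x
    rw [map_smul, hg', ← hur, ← Module.End.mul_apply, Units.mul_inv]; rfl
  have hb := h3 (r • g) (LinearMap.ext key)
  rw [Module.End.isUnit_iff]
  constructor
  · intro x y hxy
    apply hb.1
    have hxy : r • x = r • y := hxy
    simp only [LinearMap.smul_apply, ← map_smul, hxy]
  · intro y
    obtain ⟨x, hx⟩ := hb.2 y
    exact ⟨g x, hx⟩

theorem exists_free_pres (Q : Type u) [CommRing Q] (M : Type u) [AddCommGroup M] [Module Q M]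
    (h : ProjDimLE1 Q M) : ∃ (B : Type u) (L : Type u) (_ : AddCommGroup L) (_ : Module Q L)
      (p : (B →₀ Q) →ₗ[Q] M × L), Function.Surjective p ∧ Module.Free Q (LinearMap.ker p) := by
  obtain ⟨P, g, h1, h2, h3⟩ := h
  let p0 : (M →₀ Q) →ₗ[Q] M := Finsupp.linearCombination Q id
  have hs : Function.Surjective p0 := Finsupp.linearCombination_id_surjective Q M
  have hL : Module.Projective Q (LinearMap.ker p0) :=
    proj_ker_of_retract p0 hs g h2 LinearMap.id LinearMap.id (fun _ => rfl)
  obtain ⟨s, hs'⟩ := Module.projective_def'.1 hL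
  have hss : ∀ l, Finsupp.linearCombination Q id (s l) = l := fun l => LinearMap.congr_fun hs' l
  let t : (LinearMap.ker p0 →₀ Q) →ₗ[Q] LinearMap.ker p0 := Finsupp.linearCombination Q id
  have hts : ∀ l, t (s l) = l := hss
  let e := Finsupp.sumFinsuppLEquivProdFinsupp (α := M) (β := LinearMap.ker p0) (M := Q) Q
  let q := p0.prodMap t
  have hq : Function.Surjective q := by
    rintro ⟨m, l⟩
    obtain ⟨x, rfl⟩ := hs m
    exact ⟨(x, s l), by simp [q, hts]⟩
  refine ⟨M ⊕ LinearMap.ker p0, LinearMap.ker p0, inferInstance, inferInstance,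
    q ∘ₗ e.toLinearMap, hq.comp e.surjective, ?_⟩
  let E : (LinearMap.ker p0 →₀ Q) ≃ₗ[Q] LinearMap.ker (q ∘ₗ e.toLinearMap) :=
    LinearEquiv.ofLinearMap
      ((e.symm.toLinearMap ∘ₗ LinearMap.prod ((LinearMap.ker p0).subtype ∘ₗ t)
        (LinearMap.id - s ∘ₗ t)).codRestrict _ (by
          intro x
          have : p0 (t x : M →₀ Q) = 0 := (t x).2
          simp [q, hts, this]))
      (LinearMap.coprod (s ∘ₗ (LinearMap.fst Q _ _ ∘ₗ e.toLinearMap ∘ₗ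
        (LinearMap.ker (q ∘ₗ e.toLinearMap)).subtype).codRestrict (LinearMap.ker p0) (by
          rintro ⟨x, hx⟩
          exact congrArg Prod.fst hx))
        (LinearMap.snd Q _ _ ∘ₗ e.toLinearMap ∘ₗ
        (LinearMap.ker (q ∘ₗ e.toLinearMap)).subtype) ∘ₗ LinearMap.prod LinearMap.id LinearMap.id)
      (by
        refine LinearMap.ext fun x => ?_
        obtain ⟨x, hx⟩ := x
        have h2 : t (e x).2 = 0 := congrArg Prod.snd hx
        apply Subtype.ext
        apply e.injective
        apply Prod.ext
        · simp [hts, h2]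
        · simp [hts, h2])
      (by
        refine LinearMap.ext fun x => ?_
        have : ∀ h, (⟨(t x : M →₀ Q), h⟩ : LinearMap.ker p0) = t x := fun _ => rfl
        simp [LinearMap.codRestrict_apply, LinearMap.codRestrict]
        )
  exact Module.Free.of_equiv E

end helpers

/-- **Lemma 5.1(i).** Let `R` be a commutative ring with total ring of quotients `Q` and
suppose `𝒫₁(R)` is covering in `Mod-R`. Then a `Q`-module `M` has projective dimension at
most 1 over `Q` if and only if it has projective dimension at most 1 over `R`; that is,
`𝒫₁(R) ∩ Mod-Q = 𝒫₁(Q)`. -/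
theorem P1_inter_QMod (R : Type u) [CommRing R] (Q : Type u) [CommRing Q]
    [Algebra R Q] [IsFractionRing R Q]
    (hcov : IsCoveringClass R (P1Class R))
    (M : Type u) [AddCommGroup M] [Module R M] [Module Q M] [IsScalarTower R Q M] :
    ProjDimLE1 Q M ↔ ProjDimLE1 R M := by
  constructor
  · intro h
    obtain ⟨P, f, hf⟩ := hcov (ModuleCat.of R M)
    have hM : ∀ x : nonZeroDivisors R, IsUnit ((algebraMap R (Module.End R M)) x) :=
      (isLocalizedModule_id (nonZeroDivisors R) M Q).map_units
    have hP : ∀ x : nonZeroDivisors R, IsUnit ((algebraMap R (Module.End R P)) x) :=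
      fun x => cover_units R P M _ f hf x (hM x)
    obtain ⟨B, L, _, _, p, hp, hfree⟩ := exists_free_pres Q M h
    letI : Module R L := Module.compHom L (algebraMap R Q)
    haveI : IsScalarTower R Q L := IsScalarTower.of_algebraMap_smul fun _ _ => rfl
    obtain ⟨N, g, hN, hu⟩ := exists_model R Q B (M × L) p hp
    obtain ⟨k, hk⟩ := hf.2.1 N hN (LinearMap.fst R M L ∘ₗ g)
    obtain ⟨k', hk'⟩ := (hu P hP).1 k
    have hfk : LinearMap.comp f k' = LinearMap.fst R M L := by
      apply (hu M hM).2
      rw [LinearMap.comp_assoc, hk']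
      exact hk
    refine ProjDimLE1.retract (C := P) hf.1 (k' ∘ₗ LinearMap.inl R M L) f ?_
    intro m
    exact LinearMap.congr_fun hfk (m, 0)
  · exact ProjDimLE1.localize R Q M
end

section
/- Let R be a commutative ring with total ring of quotients Q. If the class 𝒫₁(R) is covering in Mod-R, then the class 𝒫₁(Q) is covering in Mod-Q. -/
universe u

open MulOpposite Function

theorem P1aux_core (R : Type u) [CommRing R] (Q : Type u) [CommRing Q]
    [Algebra R Q] [IsFractionRing R Q] (A M : Type u) [AddCommGroup A] [AddCommGroup M]
    [Module R A] [Module Q A] [IsScalarTower R Q A] [Module R M] [Module Q M] [IsScalarTower R Q M]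
    (φ : A →ₗ[Q] M)
    (hpre : ∀ (X : ModuleCat.{u} R), ProjDimLE1 R X → ∀ ψ : (X : Type u) →ₗ[R] M,
      ∃ h : (X : Type u) →ₗ[R] A, (φ.restrictScalars R).comp h = ψ)
    (I J : Type u) (w : (I →₀ Q) →ₗ[Q] (J →₀ Q)) (hw : Function.Injective w)
    (f : (J →₀ Q) →ₗ[Q] M) (hf : ∀ x, f (w x) = 0) :
    ∃ h : (J →₀ Q) →ₗ[Q] A, (∀ y, φ (h y) = f y) ∧ ∀ x, h (w x) = 0 := by
  classical
  have hinj : Function.Injective (algebraMap R Q) := IsFractionRing.injective R Q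
  let c : (J →₀ R) →ₗ[R] (J →₀ Q) := Finsupp.mapRange.linearMap (Algebra.linearMap R Q)
  have hc : Function.Injective c := by
    intro x y hxy
    ext j
    apply hinj
    have := DFunLike.congr_fun hxy j
    simpa [c] using this
  have key : ∀ i : I, ∃ s : nonZeroDivisors R, ∃ y : J →₀ R,
      c y = (s : R) • w (Finsupp.single i 1) := by
    intro i
    obtain ⟨s, hs⟩ := IsLocalization.exist_integer_multiples (nonZeroDivisors R)
      (w (Finsupp.single i 1)).support (fun j => w (Finsupp.single i 1) j)
    have hs' : ∀ j, ∃ r : R, algebraMap R Q r = (s : R) • w (Finsupp.single i 1) j := by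
      intro j
      by_cases hj : j ∈ (w (Finsupp.single i 1)).support
      · exact hs j hj
      · exact ⟨0, by simp [Finsupp.notMem_support_iff.mp hj]⟩
    choose r hr using hs'
    refine ⟨s, Finsupp.onFinset (w (Finsupp.single i 1)).support r ?_, ?_⟩
    · intro j hj
      by_contra h
      apply hj
      apply hinj
      rw [hr, Finsupp.notMem_support_iff.mp h]
      simp
    · ext j
      simp [c, hr]
  choose s y hy using key
  let w0 : (I →₀ R) →ₗ[R] (J →₀ R) := Finsupp.linearCombination R y
  let d : (I →₀ R) →ₗ[R] (I →₀ Q) :=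
    Finsupp.linearCombination R (fun i => ((s i : R)) • (Finsupp.single i (1 : Q)))
  have hcomp : ∀ x, c (w0 x) = w (d x) := by
    have : c.comp w0 = (w.restrictScalars R).comp d := by
      ext i : 1
      ext1
      simp only [LinearMap.comp_apply, w0, d, Finsupp.lsingle_apply,
        Finsupp.linearCombination_single, one_smul, hy, LinearMap.restrictScalars_apply]
      rw [← algebraMap_smul Q (s i : R) (w (Finsupp.single i 1)),
        ← algebraMap_smul Q (s i : R) (Finsupp.single i (1 : Q)), map_smul]
    exact fun x => LinearMap.congr_fun this x
  have hd' : ∀ x i, d x i = algebraMap R Q (s i * x i) := by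
    intro x i
    induction x using Finsupp.induction_linear with
    | zero => simp
    | add a b ha hb => simp only [map_add, Finsupp.add_apply, ha, hb, mul_add]
    | single k r =>
      by_cases h : k = i
      · subst h
        simp [d, Algebra.smul_def, mul_comm]
      · simp [d, h]
  have hd : Function.Injective d := by
    rw [injective_iff_map_eq_zero]
    intro x hx
    ext i
    have h1 := hd' x i
    rw [hx, Finsupp.zero_apply, eq_comm, map_eq_zero_iff _ hinj] at h1
    exact (mul_left_mem_nonZeroDivisors_eq_zero_iff (s i).2).mp h1
  have hw0 : Function.Injective w0 := by
    intro x x' h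
    apply hd
    apply hw
    rw [← hcomp, ← hcomp, h]
  let X := (J →₀ R) ⧸ LinearMap.range w0
  have hX : ProjDimLE1 R X := by
    refine ⟨ModuleCat.of R (J →₀ R), (LinearMap.range w0).mkQ, ?_, Submodule.mkQ_surjective _, ?_⟩
    · exact inferInstanceAs (Module.Projective R (J →₀ R))
    · have e : (I →₀ R) ≃ₗ[R] LinearMap.ker (LinearMap.range w0).mkQ :=
        (LinearEquiv.ofInjective w0 hw0).trans
          (LinearEquiv.ofEq _ _ (Submodule.ker_mkQ _).symm)
      exact Module.Projective.of_equiv e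
  have hle : LinearMap.range w0 ≤ LinearMap.ker ((f.restrictScalars R).comp c) := by
    rintro _ ⟨x, rfl⟩
    simp [hcomp, hf]
  obtain ⟨k', hk'⟩ := hpre (ModuleCat.of R X) hX ((LinearMap.range w0).liftQ _ hle)
  let k : (J →₀ R) →ₗ[R] A := LinearMap.comp (show X →ₗ[R] A from k') (LinearMap.range w0).mkQ
  have hk0 : ∀ x, k (w0 x) = 0 := by
    intro x
    have : (LinearMap.range w0).mkQ (w0 x) = 0 := by simp
    simp only [k, LinearMap.comp_apply, this, map_zero]
  have hkf : ∀ x, φ (k x) = f (c x) := fun x =>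
    LinearMap.congr_fun hk' ((LinearMap.range w0).mkQ x)
  let h : (J →₀ Q) →ₗ[Q] A := Finsupp.linearCombination Q (fun j => k (Finsupp.single j 1))
  have hhc : ∀ x, h (c x) = k x := by
    have : (h.restrictScalars R).comp c = k := by
      ext j
      simp [h, c]
    exact fun x => LinearMap.congr_fun this x
  refine ⟨h, ?_, ?_⟩
  · have : φ.comp h = f := by
      ext j
      simp [h, hkf, c]
    exact fun x => LinearMap.congr_fun this x
  · have : h.comp w = 0 := by
      ext i
      have h1 : (algebraMap R Q (s i)) • h (w (Finsupp.single i 1)) = 0 := by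
        rw [← map_smul, algebraMap_smul, ← hy, hhc]
        have := hk0 (Finsupp.single i 1)
        simpa [w0] using this
      have hu : IsUnit (algebraMap R Q (s i)) := IsLocalization.map_units Q (s i)
      simpa using hu.smul_eq_zero.mp h1
    exact fun x => LinearMap.congr_fun this x

theorem P1aux_lift (R : Type u) [CommRing R] (Q : Type u) [CommRing Q]
    [Algebra R Q] [IsFractionRing R Q] (A M : Type u) [AddCommGroup A] [AddCommGroup M]
    [Module R A] [Module Q A] [IsScalarTower R Q A] [Module R M] [Module Q M] [IsScalarTower R Q M]
    (φ : A →ₗ[Q] M)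
    (hpre : ∀ (X : ModuleCat.{u} R), ProjDimLE1 R X → ∀ ψ : (X : Type u) →ₗ[R] M,
      ∃ h : (X : Type u) →ₗ[R] A, (φ.restrictScalars R).comp h = ψ)
    (P' : Type u) [AddCommGroup P'] [Module Q P'] (hP' : ProjDimLE1 Q P') (ψ : P' →ₗ[Q] M) :
    ∃ h : P' →ₗ[Q] A, φ.comp h = ψ := by
  obtain ⟨P, g, hP, hg, hK⟩ := hP'
  obtain ⟨iP, hiP⟩ := Module.projective_def'.mp hP
  obtain ⟨iK, hiK⟩ := Module.projective_def'.mp hK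
  let pP : (P →₀ Q) →ₗ[Q] P := Finsupp.linearCombination Q id
  let pK : (LinearMap.ker g →₀ Q) →ₗ[Q] LinearMap.ker g := Finsupp.linearCombination Q id
  have hiP' : ∀ x, pP (iP x) = x := fun x => LinearMap.congr_fun hiP x
  have hiK' : ∀ x, pK (iK x) = x := fun x => LinearMap.congr_fun hiK x
  let e : ((P ⊕ LinearMap.ker g) →₀ Q) ≃ₗ[Q] (P →₀ Q) × (LinearMap.ker g →₀ Q) :=
    Finsupp.sumFinsuppLEquivProdFinsupp Q
  let w' : (LinearMap.ker g →₀ Q) →ₗ[Q] (P →₀ Q) × (LinearMap.ker g →₀ Q) :=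
    (iP.comp ((LinearMap.ker g).subtype.comp pK)).prod (LinearMap.id - iK.comp pK)
  have hw' : Function.Injective w' := by
    rw [injective_iff_map_eq_zero]
    intro x hx
    have h1 : iP (pK x : P) = 0 := congrArg Prod.fst hx
    have h2 : x - iK (pK x) = 0 := congrArg Prod.snd hx
    have h3 : pK x = 0 := by
      apply Subtype.ext
      rw [← hiP' (pK x : P), h1]
      simp
    simpa [h3] using h2
  let f' : (P →₀ Q) × (LinearMap.ker g →₀ Q) →ₗ[Q] M :=
    (ψ.comp (g.comp pP)).comp (LinearMap.fst Q _ _)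
  obtain ⟨h, hh1, hh2⟩ := P1aux_core R Q A M φ hpre (LinearMap.ker g) (P ⊕ LinearMap.ker g)
    (e.symm.toLinearMap.comp w') (e.symm.injective.comp hw') (f'.comp e.toLinearMap) (by
      intro x
      simp [f', w', hiP'])
  let h' : P →ₗ[Q] A := (h.comp e.symm.toLinearMap).comp ((LinearMap.inl Q _ _).comp iP)
  have hh'1 : ∀ x, φ (h' x) = ψ (g x) := by
    intro x
    simp [h', hh1, f', hiP']
  have hh'2 : LinearMap.ker g ≤ LinearMap.ker h' := by
    intro x hx
    have := hh2 (iK ⟨x, hx⟩)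
    simpa [w', hiK', h'] using this
  refine ⟨((LinearMap.ker g).liftQ h' hh'2).comp
    (g.quotKerEquivOfSurjective hg).symm.toLinearMap, ?_⟩
  ext x
  obtain ⟨p, rfl⟩ := hg x
  have : (g.quotKerEquivOfSurjective hg).symm (g p) = (LinearMap.ker g).mkQ p := by
    rw [LinearEquiv.symm_apply_eq]
    rfl
  simp [this, hh'1]

theorem P1aux_baseChange (R : Type u) [CommRing R] (Q : Type u) [CommRing Q]
    [Algebra R Q] [Module.Flat R Q] (A : Type u) [AddCommGroup A] [Module R A]
    (hA : ProjDimLE1 R A) : ProjDimLE1 Q (TensorProduct R Q A) := by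
  obtain ⟨P, g, hP, hg, hK⟩ := hA
  refine ⟨ModuleCat.of Q (TensorProduct R Q P), g.baseChange Q, ?_, ?_, ?_⟩
  · exact inferInstanceAs (Module.Projective Q (TensorProduct R Q P))
  · exact LinearMap.lTensor_surjective Q hg
  · exact Module.Projective.of_equiv (LinearMap.tensorKerEquiv Q Q g)

/-- **Lemma 5.1(ii).** Let `R` be a commutative ring with total ring of quotients `Q`.
If `𝒫₁(R)` is covering in `Mod-R`, then `𝒫₁(Q)` is covering in `Mod-Q`. -/
theorem P1Q_covering_of_P1R_covering (R : Type u) [CommRing R] (Q : Type u) [CommRing Q]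
    [Algebra R Q] [IsFractionRing R Q]
    (hcov : IsCoveringClass R (P1Class R)) :
    IsCoveringClass Q (P1Class Q) := by
  intro M
  let _ : Module R M := Module.compHom M (algebraMap R Q)
  have _ : IsScalarTower R Q M := ⟨fun r q m => by
    rw [Algebra.smul_def, mul_smul]; rfl⟩
  have _ : Module.Flat R Q := IsLocalization.flat Q (nonZeroDivisors R)
  have key : ∃ (A : ModuleCat.{u} R) (φ : A →ₗ[R] M), ProjDimLE1 R A ∧
      (∀ (X : ModuleCat.{u} R), ProjDimLE1 R X → ∀ ψ : (X : Type u) →ₗ[R] M,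
        ∃ h : (X : Type u) →ₗ[R] A, φ.comp h = ψ) ∧
      (∀ e : (A : Type u) →ₗ[R] A, φ.comp e = φ → Function.Bijective e) :=
    hcov (ModuleCat.of R M)
  obtain ⟨A, φ, hA, hpre, hend⟩ := key
  have hbij : ∀ s : nonZeroDivisors R, Function.Bijective (fun a : A => (s : R) • a) := by
    intro s
    obtain ⟨q, hq⟩ := (IsLocalization.map_units Q s).exists_right_inv
    have hq' : ∀ m : M, (s : R) • q • m = m := by
      intro m
      rw [← algebraMap_smul Q (s : R), smul_smul, hq, one_smul]
    let ψ : A →ₗ[R] M := (LinearMap.restrictScalars R (LinearMap.lsmul Q M q)).comp φ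
    obtain ⟨h, hh⟩ := hpre A hA ψ
    have hb := hend ((s : R) • h) (by
      rw [LinearMap.comp_smul, hh]
      ext a
      exact hq' (φ a))
    constructor
    · intro a b hab
      apply hb.1
      have hab' : (s : R) • a = (s : R) • b := hab
      simp only [LinearMap.smul_apply, ← map_smul, hab']
    · intro a
      obtain ⟨b, hb⟩ := hb.2 a
      exact ⟨h b, hb⟩
  let A' := TensorProduct R Q A
  let ι : A →ₗ[R] A' := TensorProduct.mk R Q A 1
  have hloc : IsLocalizedModule (nonZeroDivisors R) ι :=
    (isLocalizedModule_iff_isBaseChange (nonZeroDivisors R) Q ι).mpr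
      (TensorProduct.isBaseChange R A Q)
  have hι : Function.Bijective ι := by
    constructor
    · intro x y hxy
      obtain ⟨c, hc⟩ := IsLocalizedModule.exists_of_eq (S := nonZeroDivisors R) hxy
      exact (hbij c).1 hc
    · intro y
      obtain ⟨⟨x, s⟩, hs⟩ := IsLocalizedModule.surj (nonZeroDivisors R) ι y
      obtain ⟨x', hx'⟩ := (hbij s).2 x
      refine ⟨x', ?_⟩
      have hu : IsUnit (algebraMap R Q s) := IsLocalization.map_units Q s
      have h1 : (s : R) • y = (s : R) • ι x' := by
        rw [← map_smul]
        exact hs.trans (congrArg ι hx'.symm)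
      rw [← algebraMap_smul Q (s : R) y, ← algebraMap_smul Q (s : R) (ι x')] at h1
      exact (hu.smul_left_cancel.mp h1).symm
  let ε : A ≃ₗ[R] A' := LinearEquiv.ofBijective ι hι
  let φ' : A' →ₗ[Q] M := (TensorProduct.isBaseChange R A Q).lift φ
  have hφ' : ∀ a, φ' (ε a) = φ a := fun a => (TensorProduct.isBaseChange R A Q).lift_eq φ a
  refine ⟨ModuleCat.of Q A', φ', P1aux_baseChange R Q A hA, ?_, ?_⟩
  · intro P' hP' ψ
    refine P1aux_lift R Q A' M φ' ?_ P' hP' ψ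
    intro X hX ψ
    obtain ⟨h, hh⟩ := hpre X hX ψ
    refine ⟨ε.toLinearMap.comp h, ?_⟩
    ext x
    exact (hφ' (h x)).trans (LinearMap.congr_fun hh x)
  · intro e he
    let e0 : A' →ₗ[Q] A' := e
    have he0 : ∀ x, φ' (e0 x) = φ' x := fun x => LinearMap.congr_fun he x
    have hb := hend (ε.symm.toLinearMap.comp ((e0.restrictScalars R).comp ε.toLinearMap)) (by
      ext a
      simp only [LinearMap.comp_apply, LinearEquiv.coe_coe, LinearMap.restrictScalars_apply]
      rw [← hφ', LinearEquiv.apply_symm_apply, he0, hφ'])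
    have hb' : Function.Bijective (ε.symm ∘ e0 ∘ ε) := hb
    rw [Function.Bijective.of_comp_iff' ε.symm.bijective,
      Function.Bijective.of_comp_iff _ ε.bijective] at hb'
    exact hb'
end

section
/- Let R be a commutative semihereditary ring with total ring of quotients Q. Then the following are equivalent: (i) the class ℬ(R) = 𝒫₁(R)^⊥₁ is closed under direct sums (equivalently, the cotorsion pair (𝒫₁(R), ℬ(R)) is of finite type); (ii) Q is semisimple; (iii) R is a finite direct product of Prüfer domains. -/
universe u

open MulOpposite Function

/-- The class `ℬ(A) = 𝒫₁(A)^⊥₁` of modules `B` with `Ext¹_A(P, B) = 0` for every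
module `P` of projective dimension at most 1. -/
def BClass (A : Type u) [Ring A] : Set (ModuleCat.{u} A) :=
  {B | ∀ P : ModuleCat.{u} A, ProjDimLE1 A P → Ext1Vanishes A P B}

/-- Pushout: if Ext¹(X,Y)=0 then maps from the kernel extend. -/
theorem extend_of_ext1 {A : Type u} [Ring A] {X Y P : Type u} [AddCommGroup X] [Module A X]
    [AddCommGroup Y] [Module A Y] [AddCommGroup P] [Module A P]
    (h : Ext1Vanishes A X Y) (g : P →ₗ[A] X) (hg : Function.Surjective g)
    (f : LinearMap.ker g →ₗ[A] Y) : ∃ f' : P →ₗ[A] Y, ∀ k : LinearMap.ker g, f' k = f k := by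
  let N : Submodule A (Y × P) :=
    LinearMap.range (LinearMap.prod (-f) (LinearMap.ker g).subtype)
  have hN : ∀ k : LinearMap.ker g, ((-(f k), (k : P)) : Y × P) ∈ N := fun k => ⟨k, rfl⟩
  let i : Y →ₗ[A] (Y × P) ⧸ N := N.mkQ ∘ₗ LinearMap.inl A Y P
  let p : ((Y × P) ⧸ N) →ₗ[A] X := N.liftQ (g ∘ₗ LinearMap.snd A Y P) (by
    rintro _ ⟨k, rfl⟩
    simp)
  have hi : Function.Injective i := by
    rw [injective_iff_map_eq_zero]
    intro y hy
    have : ((y, 0) : Y × P) ∈ N := by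
      simpa [i, Submodule.Quotient.mk_eq_zero] using hy
    obtain ⟨k, hk⟩ := this
    have h1 := congrArg Prod.fst hk
    have h2 := congrArg Prod.snd hk
    simp at h1 h2
    subst h2
    simpa using h1.symm
  have hp : Function.Surjective p := by
    intro x
    obtain ⟨q, rfl⟩ := hg x
    exact ⟨N.mkQ (0, q), by simp [p]⟩
  have hr : LinearMap.range i = LinearMap.ker p := by
    apply le_antisymm
    · rintro _ ⟨y, rfl⟩
      simp [i, p]
    · intro e he
      obtain ⟨⟨y, q⟩, rfl⟩ := N.mkQ_surjective e
      have hq : g q = 0 := by simpa [p] using he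
      refine ⟨y + f ⟨q, hq⟩, ?_⟩
      have := hN ⟨q, hq⟩
      simp only [i, LinearMap.comp_apply, LinearMap.inl_apply]
      rw [← sub_eq_zero, ← map_sub, Submodule.mkQ_apply, Submodule.Quotient.mk_eq_zero]
      have h2 := N.neg_mem this
      simpa using h2
  obtain ⟨s, hs⟩ := h _ i p hi hp hr
  let j : P →ₗ[A] (Y × P) ⧸ N := N.mkQ ∘ₗ LinearMap.inr A Y P
  have hpj : ∀ q, p (j q) = g q := fun q => by simp [p, j]
  have hps : ∀ x, p (s x) = x := fun x => LinearMap.congr_fun hs x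
  have hmem : ∀ q, (j - s ∘ₗ g) q ∈ LinearMap.range i := by
    intro q
    rw [hr]
    simp [hpj, hps]
  let ei := LinearEquiv.ofInjective i hi
  refine ⟨ei.symm.toLinearMap ∘ₗ (j - s ∘ₗ g).codRestrict _ hmem, fun k => ?_⟩
  simp only [LinearMap.comp_apply, LinearEquiv.coe_coe]
  rw [LinearEquiv.symm_apply_eq]
  apply Subtype.ext
  have hk : g k = 0 := k.2
  simp only [LinearMap.codRestrict_apply, LinearMap.sub_apply, LinearMap.comp_apply, hk, map_zero,
    sub_zero, ei, LinearEquiv.ofInjective_apply]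
  simp only [i, j, LinearMap.comp_apply, LinearMap.inl_apply, LinearMap.inr_apply]
  rw [← sub_eq_zero, ← map_sub, Submodule.mkQ_apply, Submodule.Quotient.mk_eq_zero]
  simpa using hN k

theorem ext1_of_extend {A : Type u} [Ring A] {X Y P : Type u} [AddCommGroup X] [Module A X]
    [AddCommGroup Y] [Module A Y] [AddCommGroup P] [Module A P] [Module.Projective A P]
    (g : P →ₗ[A] X) (hg : Function.Surjective g)
    (h : ∀ f : LinearMap.ker g →ₗ[A] Y, ∃ f' : P →ₗ[A] Y, ∀ k : LinearMap.ker g, f' k = f k) :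
    Ext1Vanishes A X Y := by
  intro E _ _ i p hi hp hr
  obtain ⟨l, hl⟩ := Module.projective_lifting_property p g hp
  have hpl : ∀ q, p (l q) = g q := fun q => LinearMap.congr_fun hl q
  let ei := LinearEquiv.ofInjective i hi
  have hmem : ∀ k : LinearMap.ker g, (l ∘ₗ (LinearMap.ker g).subtype) k ∈ LinearMap.range i := by
    intro k
    rw [hr]
    simp [hpl]
  obtain ⟨f', hf'⟩ := h (ei.symm.toLinearMap ∘ₗ (l ∘ₗ (LinearMap.ker g).subtype).codRestrict _ hmem)
  have hif : ∀ k : LinearMap.ker g, i (f' k) = l k := by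
    intro k
    rw [hf' k]
    have : ∀ z : LinearMap.range i, i (ei.symm z) = z := fun z => by
      obtain ⟨y, rfl⟩ := ei.surjective z
      simp [ei]
    exact this _
  let d := l - i ∘ₗ f'
  have hd : LinearMap.ker g ≤ LinearMap.ker d := by
    intro k hk
    simp [d, hif ⟨k, hk⟩]
  let e := g.quotKerEquivOfSurjective hg
  refine ⟨(LinearMap.ker g).liftQ d hd ∘ₗ e.symm.toLinearMap, ?_⟩
  ext x
  obtain ⟨q, rfl⟩ := hg x
  have : e.symm (g q) = (LinearMap.ker g).mkQ q := by
    rw [LinearEquiv.symm_apply_eq]; rfl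
  have hpi : p (i (f' q)) = 0 := by
    have : i (f' q) ∈ LinearMap.ker p := hr ▸ ⟨_, rfl⟩
    exact this
  simp [this, d, hpl, hpi]

theorem injective_mem_BClass {R : Type u} [CommRing R] (E : ModuleCat.{u} R)
    (hE : Module.Injective R E) : E ∈ BClass R := by
  rintro P ⟨F, g, hF, hg, -⟩
  refine ext1_of_extend g hg fun f => ?_
  obtain ⟨f', hf'⟩ := hE.out (LinearMap.ker g).subtype (Submodule.injective_subtype _) f
  exact ⟨f', hf'⟩

/-- p.p. property -/
theorem pp_exists_idem {R : Type u} [CommRing R]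
    (hsh : ∀ I : Ideal R, I.FG → Module.Projective R I) (a : R) :
    ∃ e : R, e * e = e ∧ e * a = a ∧ ∀ r, r * a = 0 → r * e = 0 := by
  have := hsh (Ideal.span {a}) ⟨{a}, by simp⟩
  have ha : a ∈ Ideal.span {a} := Ideal.mem_span_singleton_self a
  let f : R →ₗ[R] Ideal.span {a} := LinearMap.toSpanSingleton R _ ⟨a, ha⟩
  have hf : Function.Surjective f := by
    rintro ⟨x, hx⟩
    obtain ⟨c, rfl⟩ := Ideal.mem_span_singleton'.1 hx
    exact ⟨c, Subtype.ext (by simp [f])⟩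
  obtain ⟨s, hs⟩ := Module.projective_lifting_property f LinearMap.id hf
  have h1 : s ⟨a, ha⟩ * a = a := by
    have := congrArg Subtype.val (LinearMap.congr_fun hs ⟨a, ha⟩)
    simpa [f] using this
  have h2 : ∀ r, r * s ⟨a, ha⟩ = s ⟨r * a, Ideal.mul_mem_left _ _ ha⟩ := by
    intro r
    rw [← smul_eq_mul, ← map_smul]
    rfl
  refine ⟨s ⟨a, ha⟩, ?_, h1, fun r hr => ?_⟩
  · rw [h2]
    congr 1
    exact Subtype.ext h1
  · rw [h2]
    have : (⟨r * a, Ideal.mul_mem_left _ _ ha⟩ : Ideal.span {a}) = 0 := Subtype.ext hr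
    rw [this, map_zero]

/-- no ascending chains of idempotents implies semisimple total quotient ring -/
theorem semisimple_of_no_chain {R : Type u} [CommRing R]
    (hsh : ∀ I : Ideal R, I.FG → Module.Projective R I)
    (Q : Type u) [CommRing Q] [Algebra R Q] [IsFractionRing R Q]
    (hc : ∀ a : ℕ → R, (∀ n, a n * a n = a n) → (∀ n, a n * a (n + 1) = a n) →
      (∀ n, a n ≠ a (n + 1)) → False) : IsSemisimpleRing Q := by
  let r : R → R → Prop := fun f e => f * f = f ∧ e * e = e ∧ e * f = e ∧ e ≠ f
  have wf : WellFounded r := by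
    rw [wellFounded_iff_isEmpty_descending_chain]
    constructor
    rintro ⟨a, ha⟩
    exact hc a (fun n => (ha n).2.1) (fun n => (ha n).2.2.1) (fun n => (ha n).2.2.2)
  have key : ∀ J : Ideal Q, ∃ e : R, e * e = e ∧ algebraMap R Q e ∈ J ∧
      ∀ q ∈ J, q * algebraMap R Q e = q := by
    intro J
    obtain ⟨e, ⟨he, heJ⟩, hmax⟩ := wf.has_min {e : R | e * e = e ∧ algebraMap R Q e ∈ J}
      ⟨0, by simp⟩
    refine ⟨e, he, heJ, fun q hq => ?_⟩
    obtain ⟨⟨a, s⟩, hs⟩ := IsLocalization.surj (nonZeroDivisors R) q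
    simp only at hs
    have haJ : algebraMap R Q a ∈ J := hs ▸ J.mul_mem_right _ hq
    obtain ⟨f, hf, hfa, hann⟩ := pp_exists_idem hsh a
    have hreg : a + (1 - f) ∈ nonZeroDivisors R := by
      rw [mem_nonZeroDivisors_iff_right]
      intro x hx
      have h1 : x * a = 0 := by
        have := congrArg (· * f) hx
        simp only [zero_mul] at this
        linear_combination this - x * hfa + x * hf
      have h2 := hann x h1
      linear_combination hx - h1 + h2
    obtain ⟨v, hv⟩ := (IsLocalization.map_units Q ⟨_, hreg⟩).exists_right_inv
    simp only at hv
    have hfJ : algebraMap R Q f ∈ J := by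
      have : algebraMap R Q f = algebraMap R Q a * v := by
        have h3 : f * (a + (1 - f)) = a := by linear_combination hfa - hf
        calc algebraMap R Q f = algebraMap R Q f * (algebraMap R Q (a + (1 - f)) * v) := by
              rw [hv, mul_one]
          _ = algebraMap R Q a * v := by rw [← mul_assoc, ← map_mul, h3]
      rw [this]
      exact J.mul_mem_right _ haJ
    have hg : e + f - e * f = e := by
      by_contra hne
      refine hmax (e + f - e * f) ⟨?_, ?_⟩ ⟨?_, he, ?_, fun h => hne h.symm⟩
      · linear_combination (1 - 2 * f + f * f) * he + (1 - e) * hf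
      · rw [map_sub, map_add, map_mul]
        exact J.sub_mem (J.add_mem heJ hfJ) (J.mul_mem_right _ heJ)
      · linear_combination (1 - 2 * f + f * f) * he + (1 - e) * hf
      · linear_combination (1 - f) * he
    have hae : a * e = a := by
      linear_combination (e - 1) * (-1) * hfa * 1 - a * hg
    have hsu := IsLocalization.map_units Q s
    apply hsu.mul_left_injective
    simp only
    rw [mul_right_comm, hs, ← map_mul, hae]
  have : ComplementedLattice (Ideal Q) := by
    constructor
    intro J
    obtain ⟨e, he, heJ, hJ⟩ := key J
    refine ⟨Ideal.span {1 - algebraMap R Q e}, ?_, ?_⟩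
    · rw [Submodule.disjoint_def]
      intro x hx hx2
      obtain ⟨c, rfl⟩ := Ideal.mem_span_singleton'.1 hx2
      have h1 := hJ _ hx
      have h2 : algebraMap R Q e * algebraMap R Q e = algebraMap R Q e := by rw [← map_mul, he]
      linear_combination -h1 - c * h2
    · rw [codisjoint_iff, Ideal.eq_top_iff_one]
      have := Submodule.add_mem_sup heJ (Ideal.mem_span_singleton_self (1 - algebraMap R Q e))
      rwa [add_sub_cancel] at this
  exact (isSemisimpleModule_iff Q Q).2 this

theorem no_chain_of_prod {R : Type u} [CommRing R] (n : ℕ) (D : Fin n → CommRingCat.{u})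
    (hD : ∀ i, IsDomain (D i)) (φ : R ≃+* ((i : Fin n) → (D i : Type u)))
    (a : ℕ → R) (h1 : ∀ n, a n * a n = a n) (h2 : ∀ n, a n * a (n + 1) = a n)
    (h3 : ∀ n, a n ≠ a (n + 1)) : False := by
  have hmn : ∀ m k, a m * a (m + k) = a m := by
    intro m k
    induction k with
    | zero => exact h1 m
    | succ k ih =>
      calc a m * a (m + (k + 1)) = a m * a (m + k) * a (m + k + 1) := by rw [ih]; rfl
        _ = a m * (a (m + k) * a (m + k + 1)) := by ring
        _ = a m := by rw [h2, ih]
  have hinj : Function.Injective a := by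
    intro m k hmk
    by_contra hne
    wlog hlt : m < k generalizing m k
    · exact this hmk.symm (Ne.symm hne) (by omega)
    obtain ⟨j, rfl⟩ := Nat.exists_eq_add_of_lt hlt
    apply h3 m
    have e1 := hmn (m + 1) j
    have e2 : m + 1 + j = m + j + 1 := by ring
    rw [e2, ← hmk] at e1
    rw [← h2 m, mul_comm, e1]
  have hfin : (Set.univ.pi fun i : Fin n => ({0, 1} : Set (D i))).Finite :=
    Set.Finite.pi fun i => by simp
  refine Set.infinite_range_of_injective (φ.injective.comp hinj) (hfin.subset ?_)
  rintro _ ⟨m, rfl⟩ i -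
  have := hD i
  have h : φ (a m) i * φ (a m) i = φ (a m) i := by
    rw [← Pi.mul_apply, ← map_mul, h1]
  have h' : φ (a m) i * (φ (a m) i - 1) = 0 := by linear_combination h
  rcases mul_eq_zero.1 h' with h | h
  · left; exact h
  · right; exact sub_eq_zero.1 h

theorem no_chain_of_closed {R : Type u} [CommRing R]
    (hB : ∀ (ι : Type u) (B : ι → ModuleCat.{u} R), (∀ i, B i ∈ BClass R) →
        ModuleCat.of R (DirectSum ι (fun i => (B i : Type u))) ∈ BClass R)
    (a : ℕ → R) (h1 : ∀ n, a n * a n = a n) (h2 : ∀ n, a n * a (n + 1) = a n)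
    (h3 : ∀ n, a n ≠ a (n + 1)) : False := by
  classical
  have hmn : ∀ m k, a m * a (m + k) = a m := by
    intro m k
    induction k with
    | zero => exact h1 m
    | succ k ih =>
      calc a m * a (m + (k + 1)) = a m * a (m + k) * a (m + k + 1) := by rw [ih]; rfl
        _ = a m * (a (m + k) * a (m + k + 1)) := by ring
        _ = a m := by rw [h2, ih]
  have hle : ∀ m k, m ≤ k → a m * a k = a m := fun m k h => by
    obtain ⟨j, rfl⟩ := Nat.exists_eq_add_of_le h
    exact hmn m j
  let d : ULift.{u} ℕ → R := fun n => a (n.down + 1) - a n.down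
  have hd0 : ∀ n, d n ≠ 0 := fun n h => h3 n.down (sub_eq_zero.1 h).symm
  have hdd : ∀ n, d n * d n = d n := fun n => by
    simp only [d]
    linear_combination h1 (n.down + 1) + h1 n.down - 2 * h2 n.down
  have horth' : ∀ m n : ℕ, m < n → (a (m + 1) - a m) * (a (n + 1) - a n) = 0 := fun m n h => by
    linear_combination hle (m + 1) (n + 1) (by omega) - hle (m + 1) n (by omega)
      - hle m (n + 1) (by omega) + hle m n (by omega)
  have horth : ∀ m n, m ≠ n → d m * d n = 0 := by
    rintro ⟨m⟩ ⟨n⟩ hne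
    rcases lt_trichotomy m n with h | h | h
    · exact horth' m n h
    · exact absurd (congrArg ULift.up h) hne
    · rw [mul_comm]; exact horth' n m h
  let I : Ideal R := Ideal.span (Set.range d)
  have hfin : ∀ x ∈ I, (Function.support fun n => x * d n).Finite := by
    intro x hx
    induction hx using Submodule.span_induction with
    | mem x hx =>
      obtain ⟨m, rfl⟩ := hx
      refine (Set.finite_singleton m).subset fun n hn => ?_
      by_contra hne
      exact hn (horth m n (fun h => hne h.symm))
    | zero => simp
    | add x y _ _ hx hy =>
      refine (hx.union hy).subset fun n hn => ?_
      by_contra hne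
      simp only [Set.mem_union, Function.mem_support, not_or, not_not] at hne
      exact hn (by simp only; rw [add_mul, hne.1, hne.2, add_zero])
    | smul r x _ hx =>
      refine hx.subset fun n hn => ?_
      by_contra hne
      simp only [Function.mem_support, not_not] at hne
      exact hn (by simp only; rw [smul_eq_mul, mul_assoc, hne, mul_zero])
  let s : I →ₗ[R] (ULift.{u} ℕ →₀ R) :=
    { toFun := fun x => Finsupp.ofSupportFinite (fun n => (x : R) * d n) (hfin x x.2)
      map_add' := fun x y => by
        ext n; simp [Finsupp.ofSupportFinite_coe, add_mul]
      map_smul' := fun r x => by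
        ext n; simp [Finsupp.ofSupportFinite_coe, mul_assoc] }
  have hs : ∀ x n, s x n = (x : R) * d n := fun x n => rfl
  let t : (ULift.{u} ℕ →₀ R) →ₗ[R] I :=
    Finsupp.linearCombination R (fun n => (⟨d n, Ideal.subset_span ⟨n, rfl⟩⟩ : I))
  have hsd : ∀ n, s ⟨d n, Ideal.subset_span ⟨n, rfl⟩⟩ = Finsupp.single n (d n) := by
    intro n
    ext m
    rw [hs]
    by_cases h : n = m
    · subst h; simp [hdd]
    · simp [h, horth n m h]
  have hts : t ∘ₗ s = LinearMap.id := by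
    ext x
    obtain ⟨x, hx⟩ := x
    simp only [LinearMap.comp_apply, LinearMap.id_apply]
    induction hx using Submodule.span_induction with
    | mem x hx =>
      obtain ⟨m, rfl⟩ := hx
      rw [hsd]
      simp [t, hdd]
    | zero =>
      have : (⟨0, Submodule.zero_mem _⟩ : I) = 0 := rfl
      rw [this]; simp
    | add x y hx hy ihx ihy =>
      have : (⟨x + y, Submodule.add_mem _ hx hy⟩ : I) = ⟨x, hx⟩ + ⟨y, hy⟩ := rfl
      rw [this, map_add, map_add, Submodule.coe_add, ihx, ihy]
    | smul r x hx ihx =>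
      have : (⟨r • x, Submodule.smul_mem _ r hx⟩ : I) = r • ⟨x, hx⟩ := rfl
      rw [this, map_smul, map_smul, Submodule.coe_smul, ihx]
  have hI : Module.Projective R I := Module.Projective.of_split s t hts
  -- an injective module containing R
  let E : ModuleCat.{u} R := CategoryTheory.Injective.under (ModuleCat.of R R)
  have hE : Module.Injective R E :=
    Module.injective_module_of_injective_object R E
      (inj := inferInstanceAs
        (CategoryTheory.Injective (CategoryTheory.Injective.under (ModuleCat.of R R))))
  let j : R →ₗ[R] E := (CategoryTheory.Injective.ι (ModuleCat.of R R)).hom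
  have hj : Function.Injective j :=
    (ModuleCat.mono_iff_injective (CategoryTheory.Injective.ι (ModuleCat.of R R))).1 inferInstance
  have hsum := hB (ULift.{u} ℕ) (fun _ => E) (fun _ => injective_mem_BClass E hE)
  let g : R →ₗ[R] R ⧸ I := I.mkQ
  have hg : Function.Surjective g := I.mkQ_surjective
  have hker : LinearMap.ker g = I := I.ker_mkQ
  have hpd : ProjDimLE1 R (R ⧸ I) :=
    ⟨ModuleCat.of R R, g, inferInstanceAs (Module.Projective R R), hg, by
      rw [hker]; exact hI⟩
  have hext := hsum (ModuleCat.of R (R ⧸ I)) hpd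
  let c : (ULift.{u} ℕ →₀ R) →ₗ[R] DirectSum (ULift.{u} ℕ) (fun _ => (E : Type u)) :=
    Finsupp.lsum R (fun n => DirectSum.lof R (ULift.{u} ℕ) (fun _ => (E : Type u)) n ∘ₗ j)
  obtain ⟨f', hf'⟩ := extend_of_ext1 (P := R) hext g hg
    (c ∘ₗ s ∘ₗ (LinearEquiv.ofEq _ _ hker).toLinearMap)
  have hval : ∀ n, d n • f' 1 = DirectSum.lof R (ULift.{u} ℕ) (fun _ => (E : Type u)) n (j (d n)) := by
    intro n
    have hm : d n ∈ LinearMap.ker g := by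
      rw [hker]; exact Ideal.subset_span ⟨n, rfl⟩
    have := hf' ⟨d n, hm⟩
    rw [← map_smul, smul_eq_mul, mul_one]
    refine this.trans ?_
    have e : (LinearEquiv.ofEq _ _ hker) ⟨d n, hm⟩ =
      (⟨d n, Ideal.subset_span ⟨n, rfl⟩⟩ : I) := rfl
    simp only [LinearMap.comp_apply, LinearEquiv.coe_coe]
    rw [e, hsd]
    simp [c]
  -- f' 1 has finite support
  let y : DirectSum (ULift.{u} ℕ) (fun _ => (E : Type u)) := f' 1
  have hy : ∀ n, y n ≠ 0 := by
    intro n h0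
    have := congrArg (fun z : DirectSum (ULift.{u} ℕ) (fun _ => (E : Type u)) => z n) (hval n)
    simp only [DirectSum.lof_apply] at this
    have h4 : d n • y n = j (d n) := this
    rw [h0, smul_zero] at h4
    exact hd0 n (hj (h4.symm.trans (map_zero j).symm))
  exact Set.infinite_univ (α := ULift.{u} ℕ)
    ((DFinsupp.finite_support y).subset fun n _ => hy n)

theorem semihered_of_retract {R D : Type u} [CommRing R] [CommRing D] [Algebra R D]
    (hsh : ∀ I : Ideal R, I.FG → Module.Projective R I)
    (hsurj : Function.Surjective (algebraMap R D))
    (ρ : D →ₗ[R] R) (hρ : Function.Injective ρ) (I : Ideal D) (hI : I.FG) :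
    Module.Projective D I := by
  have h1 : (I.restrictScalars R).FG := Submodule.FG.restrictScalars_of_surjective hI hsurj
  have h2 := hsh (Submodule.map ρ (I.restrictScalars R)) (h1.map ρ)
  let eq := Submodule.equivMapOfInjective ρ hρ (I.restrictScalars R)
  have h3 : Module.Projective R (I.restrictScalars R) := Module.Projective.of_equiv eq.symm
  have h3' : Module.Projective R I := h3
  refine Module.Projective.of_lifting_property'' fun f hf => ?_
  obtain ⟨σ, hσ⟩ := Module.projective_lifting_property (f.restrictScalars R)
    (LinearMap.id : I →ₗ[R] I) hf
  refine ⟨σ.extendScalarsOfSurjective hsurj, ?_⟩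
  ext x
  have := LinearMap.congr_fun hσ x
  exact congrArg Subtype.val this

theorem prod_of_semisimple {R : Type u} [CommRing R]
    (hsh : ∀ I : Ideal R, I.FG → Module.Projective R I)
    (Q : Type u) [CommRing Q] [Algebra R Q] [IsFractionRing R Q] (hQ : IsSemisimpleRing Q) :
    ∃ (n : ℕ) (D : Fin n → CommRingCat.{u}),
        (∀ i, IsDomain (D i)) ∧
        (∀ i, ∀ I : Ideal (D i), I.FG → Module.Projective (D i) I) ∧
        Nonempty (R ≃+* ((i : Fin n) → (D i : Type u))) := by
  classical
  have hart : IsArtinianRing Q := inferInstance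
  have hred : IsReduced Q := inferInstance
  have hinj : Function.Injective (algebraMap R Q) := IsFractionRing.injective R Q
  have : Finite (MaximalSpectrum Q) := inferInstance
  have : Fintype (MaximalSpectrum Q) := Fintype.ofFinite _
  obtain ⟨n, ⟨en⟩⟩ := Finite.exists_equiv_fin (MaximalSpectrum Q)
  have hlift : ∀ q : Q, q * q = q → ∃ e : R, algebraMap R Q e = q := by
    intro q hq
    obtain ⟨⟨a, s⟩, hs⟩ := IsLocalization.surj (nonZeroDivisors R) q
    simp only at hs
    obtain ⟨e, he, hea, hann⟩ := pp_exists_idem hsh a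
    refine ⟨e, ?_⟩
    have hsu := IsLocalization.map_units Q s
    have h1 : algebraMap R Q e * q = q := by
      apply hsu.mul_left_injective
      simp only
      rw [mul_assoc, hs, ← map_mul, hea]
    have h2 : (s - a) * e = 0 := by
      apply hann
      apply hinj
      rw [map_mul, map_sub, map_zero, ← hs]
      linear_combination (- algebraMap R Q s * algebraMap R Q s) * hq
    have h3 := congrArg (algebraMap R Q) h2
    rw [map_mul, map_sub, map_zero, ← hs] at h3
    apply hsu.mul_left_injective
    simp only
    linear_combination h3 + algebraMap R Q s * h1
  let eq := IsArtinianRing.equivPi Q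
  let ε : Fin n → Q := fun i => eq.symm (Pi.single (en.symm i) 1)
  have hε : CompleteOrthogonalIdempotents ε := by
    have h0 := CompleteOrthogonalIdempotents.single (fun I : MaximalSpectrum Q => Q ⧸ I.asIdeal)
    have h1 := h0.map eq.symm.toAlgHom.toRingHom
    exact (CompleteOrthogonalIdempotents.equiv en.symm).2 h1
  choose e he using fun i => hlift (ε i) (hε.idem i)
  have hec : CompleteOrthogonalIdempotents e := by
    refine ⟨⟨fun i => ?_, fun i j hij => ?_⟩, ?_⟩
    · apply hinj; rw [map_mul, he, (hε.idem i).eq]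
    · apply hinj; simp only [map_mul, he, map_zero]; exact hε.ortho hij
    · apply hinj; rw [map_sum, map_one]; simp only [he]; exact hε.complete
  have hbij := hec.bijective_pi
  refine ⟨n, fun i => CommRingCat.of (R ⧸ Ideal.span {1 - e i}), fun i => ?_, fun i => ?_,
    ⟨RingEquiv.ofBijective _ hbij⟩⟩
  · change IsDomain (R ⧸ Ideal.span {1 - e i})
    rw [Ideal.Quotient.isDomain_iff_prime]
    have hmem : ∀ x, x ∈ Ideal.span {1 - e i} ↔ eq (algebraMap R Q x) (en.symm i) = 0 := by
      intro x
      have h1 : x ∈ Ideal.span {1 - e i} ↔ e i * x = 0 := by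
        rw [Ideal.mem_span_singleton']
        constructor
        · rintro ⟨c, rfl⟩
          have := (hec.idem i).eq
          linear_combination -c * this
        · intro h
          exact ⟨x, by linear_combination -h⟩
      rw [h1, ← hinj.eq_iff, map_mul, he, map_zero, ← eq.injective.eq_iff, map_mul, map_zero]
      simp only [ε, AlgEquiv.apply_symm_apply]
      constructor
      · intro h
        simpa using congrFun h (en.symm i)
      · intro h
        ext k
        by_cases hk : k = en.symm i
        · subst hk; simp [h]
        · simp [hk]
    have hdom : IsDomain (Q ⧸ (en.symm i).asIdeal) := by
      have := (en.symm i).isMaximal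
      infer_instance
    constructor
    · rw [Ideal.ne_top_iff_one, hmem]
      simp
    · intro x y hxy
      rw [hmem] at hxy ⊢
      rw [hmem]
      rw [map_mul, map_mul, Pi.mul_apply] at hxy
      exact mul_eq_zero.1 hxy
  · change ∀ I : Ideal (R ⧸ Ideal.span {1 - e i}), I.FG → _
    have hidem := (hec.idem i).eq
    let ρ : (R ⧸ Ideal.span {1 - e i}) →ₗ[R] R :=
      Submodule.liftQ (Ideal.span {1 - e i}) (LinearMap.mulLeft R (e i)) (by
        refine Ideal.span_le.2 ?_
        simp [mul_sub, hidem])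
    refine fun I hI => semihered_of_retract hsh Ideal.Quotient.mk_surjective ρ ?_ I hI
    rw [injective_iff_map_eq_zero]
    intro z hz
    obtain ⟨x, rfl⟩ := Ideal.Quotient.mk_surjective z
    have hx : e i * x = 0 := hz
    rw [Ideal.Quotient.eq_zero_iff_mem, Ideal.mem_span_singleton']
    exact ⟨x, by linear_combination -hx⟩

theorem fg_inf_ker {R : Type u} [CommRing R]
    (hsh : ∀ I : Ideal R, I.FG → Module.Projective R I) {V : Type u} [AddCommGroup V] [Module R V]
    (U : Submodule R V) (hU : U.FG) (φ : V →ₗ[R] R) : (U ⊓ LinearMap.ker φ).FG := by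
  have := hsh (U.map φ) (hU.map φ)
  let f : U →ₗ[R] U.map φ := φ.submoduleMap U
  have hf : Function.Surjective f := φ.submoduleMap_surjective U
  obtain ⟨σ, hσ⟩ := Module.projective_lifting_property f LinearMap.id hf
  have hσ' : ∀ y, φ (σ y : V) = y := fun y => congrArg Subtype.val (LinearMap.congr_fun hσ y)
  have hfin : Module.Finite R U := Module.Finite.iff_fg.2 hU
  have : U ⊓ LinearMap.ker φ = Submodule.map (U.subtype ∘ₗ (LinearMap.id - σ ∘ₗ f)) ⊤ := by
    apply le_antisymm
    · rintro v ⟨hv, hv0⟩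
      refine ⟨⟨v, hv⟩, trivial, ?_⟩
      have : f ⟨v, hv⟩ = 0 := Subtype.ext hv0
      simp [this]
    · rintro _ ⟨u, -, rfl⟩
      refine ⟨Subtype.mem ((LinearMap.id - σ ∘ₗ f : U →ₗ[R] U) u), ?_⟩
      simp only [SetLike.mem_coe, LinearMap.mem_ker]
      simp only [LinearMap.comp_apply, LinearMap.sub_apply, LinearMap.id_apply,
        Submodule.subtype_apply, map_sub, hσ']
      exact sub_self _
  rw [this]
  exact (Module.Finite.fg_top).map _

theorem fg_inf_supported {R : Type u} [CommRing R]
    (hsh : ∀ I : Ideal R, I.FG → Module.Projective R I) {Z : Type u}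
    (U : Submodule R (Z →₀ R)) (hU : U.FG) (A : Set Z) :
    (U ⊓ Finsupp.supported R R A).FG := by
  classical
  have h1 : ∀ F : Finset Z, ∃ L : Submodule R (Z →₀ R), L.FG ∧
      ∀ v, v ∈ L ↔ v ∈ U ∧ ∀ z ∈ F, v z = 0 := by
    intro F
    induction F using Finset.induction_on with
    | empty => exact ⟨U, hU, by simp⟩
    | insert z F _ ih =>
      obtain ⟨L, hL, hL'⟩ := ih
      refine ⟨_, fg_inf_ker hsh L hL (Finsupp.lapply z), fun v => ?_⟩
      simp only [Submodule.mem_inf, hL', LinearMap.mem_ker, Finsupp.lapply_apply,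
        Finset.mem_insert, forall_eq_or_imp]
      tauto
  obtain ⟨T, hT⟩ := hU
  let F : Finset Z := T.biUnion fun v => v.support
  have hF : U ≤ Finsupp.supported R R (F : Set Z) := by
    rw [← hT, Submodule.span_le]
    intro v hv
    rw [SetLike.mem_coe, Finsupp.mem_supported]
    exact_mod_cast Finset.subset_biUnion_of_mem (fun v : Z →₀ R => v.support) hv
  obtain ⟨L, hL, hL'⟩ := h1 (F.filter (· ∉ A))
  convert hL
  ext v
  rw [hL', Submodule.mem_inf]
  refine and_congr_right fun hv => ?_
  rw [Finsupp.mem_supported']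
  constructor
  · intro h z hz
    exact h z (Finset.mem_filter.1 hz).2
  · intro h z hz
    by_cases hzF : z ∈ F
    · exact h z (Finset.mem_filter.2 ⟨hzF, hz⟩)
    · exact (Finsupp.mem_supported' R v).1 (hF hv) z (by exact_mod_cast hzF)

/-- closed index sets -/
def GoodSet {R : Type u} [CommRing R] {Z : Type u} {K : Submodule R (Z →₀ R)}
    (s : K →ₗ[R] (K →₀ R)) (S : Set Z) : Prop :=
  ∀ k : K, (k : Z →₀ R) ∈ Finsupp.supported R R S → ∀ k' ∈ (s k).support,
    (k' : Z →₀ R) ∈ Finsupp.supported R R S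

theorem good_finite {R : Type u} [CommRing R]
    (Q : Type u) [CommRing Q] [Algebra R Q] [IsFractionRing R Q] [IsNoetherianRing Q]
    {Z : Type u} {K : Submodule R (Z →₀ R)}
    (s : K →ₗ[R] (K →₀ R)) (S : Set Z) (hS : GoodSet s S) (X : Finset Z) :
    ∃ W : Finset K, ∀ k : K, (k : Z →₀ R) ∈ Finsupp.supported R R (S ∪ X) →
      ∀ k' ∈ (s k).support, k' ∈ W ∨ (k' : Z →₀ R) ∈ Finsupp.supported R R S := by
  classical
  let θ : K → (X → Q) := fun k x => algebraMap R Q ((k : Z →₀ R) x)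
  let N : Set K := {k | (k : Z →₀ R) ∈ Finsupp.supported R R (S ∪ X)}
  have hfg : (Submodule.span Q (θ '' N)).FG := IsNoetherian.noetherian _
  obtain ⟨s', hs'N, hs'⟩ := (Submodule.fg_span_iff_fg_span_finset_subset _).1 hfg
  obtain ⟨w, hwN, hw⟩ := Finset.subset_set_image_iff.1 hs'N
  refine ⟨w.biUnion fun n => (s n).support, fun k hk k' hk' => ?_⟩
  by_contra hcon
  push Not at hcon
  obtain ⟨hk'W, hk'S⟩ := hcon
  have hmem : θ k ∈ Submodule.span Q (θ '' (w : Set K)) := by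
    have : θ k ∈ Submodule.span Q (θ '' N) := Submodule.subset_span ⟨k, hk, rfl⟩
    rw [hs', ← hw] at this
    simpa using this
  obtain ⟨q₀, hq₀⟩ := (Submodule.mem_span_image_finset_iff_exists_fun Q).1 hmem
  obtain ⟨q, hq⟩ : ∃ q : K → Q, ∑ n ∈ w, q n • θ n = θ k := by
    refine ⟨fun n => if h : n ∈ w then q₀ ⟨n, h⟩ else 0, ?_⟩
    rw [← hq₀, ← Finset.sum_coe_sort w]
    refine Finset.sum_congr rfl fun n _ => ?_
    simp
  obtain ⟨c, hc⟩ := IsLocalization.exist_integer_multiples (nonZeroDivisors R) w q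
  choose! r hr using hc
  let k0 : K := (c : R) • k - ∑ n ∈ w, r n • n
  have hk0c : ∀ z, (k0 : Z →₀ R) z = (c : R) * (k : Z →₀ R) z - ∑ n ∈ w, r n * (n : Z →₀ R) z := by
    intro z
    simp [k0]
  have hk0S : (k0 : Z →₀ R) ∈ Finsupp.supported R R S := by
    rw [Finsupp.mem_supported']
    intro z hz
    rw [hk0c]
    by_cases hzX : z ∈ X
    · apply IsFractionRing.injective R Q
      have h1 := congrFun hq ⟨z, hzX⟩
      simp only [Finset.sum_apply, Pi.smul_apply, smul_eq_mul, θ] at h1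
      rw [map_sub, map_mul, map_sum, map_zero, ← h1, Finset.mul_sum, ← Finset.sum_sub_distrib]
      refine Finset.sum_eq_zero fun n hn => ?_
      have h2 := hr n hn
      rw [Algebra.smul_def] at h2
      rw [map_mul, h2]
      ring
    · have hzU : z ∉ S ∪ (X : Set Z) := by simp [hz, hzX]
      rw [(Finsupp.mem_supported' R _).1 hk z hzU, mul_zero, zero_sub, neg_eq_zero]
      refine Finset.sum_eq_zero fun n hn => ?_
      rw [(Finsupp.mem_supported' R _).1 (hwN hn) z hzU, mul_zero]
  have h3 : s k0 k' = (c : R) * s k k' := by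
    have e1 : s k0 = (c : R) • s k - ∑ n ∈ w, r n • s n := by
      have e0 : (c : R) • k = k0 + ∑ n ∈ w, r n • n := by
        apply Subtype.ext
        apply Finsupp.ext
        intro z
        have := hk0c z
        simp only [Submodule.coe_add, Finsupp.add_apply, this]
        simp
      have e2 := congrArg s e0
      rw [map_add, map_smul, map_sum] at e2
      simp only [map_smul] at e2
      rw [e2, add_sub_cancel_right]
    rw [e1, Finsupp.sub_apply, Finsupp.smul_apply, Finsupp.finsetSum_apply, smul_eq_mul,
      Finset.sum_eq_zero, sub_zero]
    intro n hn
    have : k' ∉ (s n).support := fun h => hk'W (Finset.mem_biUnion.2 ⟨n, hn, h⟩)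
    rw [Finsupp.smul_apply, Finsupp.notMem_support_iff.1 this, smul_zero]
  have h4 : k' ∈ (s k0).support := by
    rw [Finsupp.mem_support_iff, h3]
    intro h
    rw [mul_comm] at h
    exact Finsupp.mem_support_iff.1 hk' ((mem_nonZeroDivisors_iff_right.1 c.2) _ h)
  exact hk'S (hS k0 hk0S k' h4)

theorem good_fg {R : Type u} [CommRing R]
    (hsh : ∀ I : Ideal R, I.FG → Module.Projective R I)
    (Q : Type u) [CommRing Q] [Algebra R Q] [IsFractionRing R Q] [IsNoetherianRing Q]
    {Z : Type u} {K : Submodule R (Z →₀ R)}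
    (s : K →ₗ[R] (K →₀ R)) (hs : ∀ k, Finsupp.linearCombination R id (s k) = k)
    (S : Set Z) (hS : GoodSet s S) (X : Finset Z) (x : Z) :
    (Submodule.comap (Finsupp.lsingle x : R →ₗ[R] (Z →₀ R))
      (K ⊔ Finsupp.supported R R (S ∪ X))).FG := by
  classical
  by_cases hx : x ∈ S ∪ (X : Set Z)
  · have : Submodule.comap (Finsupp.lsingle x : R →ₗ[R] (Z →₀ R))
      (K ⊔ Finsupp.supported R R (S ∪ X)) = ⊤ := by
      rw [eq_top_iff]
      intro r _
      exact Submodule.mem_sup_right (Finsupp.single_mem_supported R r hx)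
    rw [this]
    exact Module.Finite.fg_top
  have hxS : x ∉ S := fun h => hx (Or.inl h)
  obtain ⟨W, hW⟩ := good_finite Q s S hS (insert x X)
  let U : Submodule R (Z →₀ R) := Submodule.span R (K.subtype '' (W : Set K))
  have hUK : U ≤ K := by
    refine Submodule.span_le.2 ?_
    rintro _ ⟨k, -, rfl⟩
    exact k.2
  have hU : U.FG := Submodule.fg_span (W.finite_toSet.image _)
  let A : Set Z := S ∪ ((insert x X : Finset Z) : Set Z)
  have hL := fg_inf_supported hsh U hU A
  have hsub : S ∪ (X : Set Z) ⊆ A := Set.union_subset_union_right _ (by simp)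
  have hxA : x ∈ A := by simp [A]
  convert hL.map (Finsupp.lapply x : (Z →₀ R) →ₗ[R] R)
  apply le_antisymm
  · intro r hr
    obtain ⟨k, hk, v, hv, hkv⟩ := Submodule.mem_sup.1 hr
    simp only [Finsupp.lsingle_apply] at hkv
    have hvx : v x = 0 := (Finsupp.mem_supported' R v).1 hv x hx
    have hkA : k ∈ Finsupp.supported R R A := by
      rw [← eq_sub_iff_add_eq] at hkv
      rw [hkv]
      exact Submodule.sub_mem _ (Finsupp.single_mem_supported R r hxA)
        (Finsupp.supported_mono hsub hv)
    have hkx : k x = r := by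
      have := DFunLike.congr_fun hkv x
      simpa [hvx] using this
    let k1 : K := ⟨k, hk⟩
    let t : K := ∑ k' ∈ (s k1).support.filter (· ∉ W), s k1 k' • k'
    let w : K := ∑ k' ∈ (s k1).support.filter (· ∈ W), s k1 k' • k'
    have hsum : w + t = k1 := by
      have h := hs k1
      rw [Finsupp.linearCombination_apply, Finsupp.sum] at h
      rw [← h]
      simp only [w, t, id]
      exact Finset.sum_filter_add_sum_filter_not _ _ _
    have ht : (t : Z →₀ R) ∈ Finsupp.supported R R S := by
      simp only [t, Submodule.coe_sum, Submodule.coe_smul]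
      refine Submodule.sum_mem _ fun k' hk' => Submodule.smul_mem _ _ ?_
      rw [Finset.mem_filter] at hk'
      exact (hW k1 hkA k' hk'.1).resolve_left hk'.2
    have hwU : (w : Z →₀ R) ∈ U := by
      simp only [w, Submodule.coe_sum, Submodule.coe_smul]
      refine Submodule.sum_mem _ fun k' hk' => Submodule.smul_mem _ _ ?_
      rw [Finset.mem_filter] at hk'
      exact Submodule.subset_span ⟨k', hk'.2, rfl⟩
    have hwk : (w : Z →₀ R) = k - t := by
      rw [eq_sub_iff_add_eq, ← Submodule.coe_add, hsum]
    refine ⟨w, ⟨hwU, ?_⟩, ?_⟩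
    · rw [SetLike.mem_coe, hwk]
      exact Submodule.sub_mem _ hkA (Finsupp.supported_mono Set.subset_union_left ht)
    · rw [Finsupp.lapply_apply, hwk, Finsupp.sub_apply, hkx,
        (Finsupp.mem_supported' R _).1 ht x hxS, sub_zero]
  · rintro _ ⟨v, ⟨hvU, hvA⟩, rfl⟩
    rw [Submodule.mem_comap, Finsupp.lapply_apply, Finsupp.lsingle_apply]
    have : Finsupp.single x (v x) = v + (Finsupp.single x (v x) - v) := by abel
    rw [this]
    refine Submodule.add_mem_sup (hUK hvU) ?_
    rw [Finsupp.mem_supported']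
    intro z hz
    by_cases hzx : z = x
    · subst hzx; simp
    · have hzA : z ∉ A := by
        simp only [A, Set.mem_union, Finset.coe_insert, Set.mem_insert_iff, not_or] at hz ⊢
        exact ⟨hz.1, hzx, hz.2⟩
      have := (Finsupp.mem_supported' R v).1 hvA z hzA
      simp [this, Ne.symm hzx]

theorem pmap_step {R : Type u} [CommRing R]
    (hsh : ∀ I : Ideal R, I.FG → Module.Projective R I)
    (Q : Type u) [CommRing Q] [Algebra R Q] [IsFractionRing R Q] [IsNoetherianRing Q]
    {Z : Type u} {K : Submodule R (Z →₀ R)}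
    (s : K →ₗ[R] (K →₀ R)) (hs : ∀ k, Finsupp.linearCombination R id (s k) = k)
    {B : Type u} [AddCommGroup B] [Module R B]
    (hB : ∀ J : Ideal R, J.FG → ∀ f : J →ₗ[R] B, ∃ b, ∀ j : J, f j = (j : R) • b)
    (S : Set Z) (hS : GoodSet s S) (X : Finset Z) (x : Z) (p : (Z →₀ R) →ₗ.[R] B)
    (hp : p.domain = K ⊔ Finsupp.supported R R (S ∪ X)) :
    ∃ p' : (Z →₀ R) →ₗ.[R] B, p ≤ p' ∧
      p'.domain = K ⊔ Finsupp.supported R R (insert x (S ∪ X)) := by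
  classical
  let J : Ideal R := Submodule.comap (Finsupp.lsingle x : R →ₗ[R] (Z →₀ R)) p.domain
  have hJ : J.FG := by
    have := good_fg hsh Q s hs S hS X x
    rw [← hp] at this
    exact this
  let f : J →ₗ[R] B := p.toFun ∘ₗ ((Finsupp.lsingle x : R →ₗ[R] (Z →₀ R)).restrict
    (p := J) (q := p.domain) (fun _ h => h))
  obtain ⟨b, hb⟩ := hB J hJ f
  have hH : ∀ c : R, c • (Finsupp.single x (1 : R)) = 0 → (RingHom.id R) c • b = 0 := by
    intro c hc
    have : c = 0 := by simpa using hc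
    simp [this]
  let q : (Z →₀ R) →ₗ.[R] B := LinearPMap.mkSpanSingleton' (Finsupp.single x (1 : R)) b hH
  have hq : q.domain = Submodule.span R {Finsupp.single x (1 : R)} := rfl
  have hcomp : ∀ (y : p.domain) (z : q.domain), (y : Z →₀ R) = z → p y = q z := by
    rintro ⟨y, hy⟩ ⟨z, hz⟩ rfl
    obtain ⟨c, rfl⟩ := Submodule.mem_span_singleton.1 hz
    rw [LinearPMap.mkSpanSingleton'_apply]
    have hcJ : c ∈ J := by
      simpa [J] using hy
    have := hb ⟨c, hcJ⟩
    rw [RingHom.id_apply, ← this]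
    have e : (⟨c • Finsupp.single x 1, hy⟩ : p.domain) = ⟨Finsupp.single x c, hcJ⟩ :=
      Subtype.ext (by simp)
    rw [e]
    rfl
  refine ⟨p.sup q hcomp, LinearPMap.left_le_sup _ _ _, ?_⟩
  have e1 : Finsupp.supported R R ({x} : Set Z) = Submodule.span R {Finsupp.single x (1 : R)} := by
    rw [Finsupp.supported_eq_span_single, Set.image_singleton]
  have e2 : Finsupp.supported R R (insert x (S ∪ (X : Set Z))) =
      Finsupp.supported R R {x} ⊔ Finsupp.supported R R (S ∪ (X : Set Z)) := by
    rw [Set.insert_eq, Finsupp.supported_union]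
  rw [LinearPMap.domain_sup, hp, hq, e2, e1, sup_assoc, sup_comm (Submodule.span R _)]

theorem pmap_step_fin {R : Type u} [CommRing R]
    (hsh : ∀ I : Ideal R, I.FG → Module.Projective R I)
    (Q : Type u) [CommRing Q] [Algebra R Q] [IsFractionRing R Q] [IsNoetherianRing Q]
    {Z : Type u} {K : Submodule R (Z →₀ R)}
    (s : K →ₗ[R] (K →₀ R)) (hs : ∀ k, Finsupp.linearCombination R id (s k) = k)
    {B : Type u} [AddCommGroup B] [Module R B]
    (hB : ∀ J : Ideal R, J.FG → ∀ f : J →ₗ[R] B, ∃ b, ∀ j : J, f j = (j : R) • b)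
    (S : Set Z) (hS : GoodSet s S) (X X' : Finset Z) (hXX' : X ⊆ X') (p : (Z →₀ R) →ₗ.[R] B)
    (hp : p.domain = K ⊔ Finsupp.supported R R (S ∪ X)) :
    ∃ p' : (Z →₀ R) →ₗ.[R] B, p ≤ p' ∧
      p'.domain = K ⊔ Finsupp.supported R R (S ∪ X') := by
  classical
  have key : ∀ Y : Finset Z, ∃ p' : (Z →₀ R) →ₗ.[R] B, p ≤ p' ∧
      p'.domain = K ⊔ Finsupp.supported R R (S ∪ ((Y ∪ X : Finset Z) : Set Z)) := by
    intro Y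
    induction Y using Finset.induction_on with
    | empty => exact ⟨p, le_rfl, by rw [hp]; simp⟩
    | insert x Y _ ih =>
      obtain ⟨p1, h1, h2⟩ := ih
      obtain ⟨p2, h3, h4⟩ := pmap_step hsh Q s hs hB S hS _ x p1 h2
      refine ⟨p2, h1.trans h3, ?_⟩
      rw [h4, Finset.insert_union, Finset.coe_insert, Set.union_insert]
  have := key X'
  rwa [Finset.union_eq_left.2 hXX'] at this

theorem supported_directed {R : Type u} [CommRing R] {Z : Type u} {ι : Type u} [Nonempty ι]
    (S : ι → Set Z) (hd : Directed (· ⊆ ·) S) (v : Z →₀ R)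
    (hv : v ∈ Finsupp.supported R R (⋃ i, S i)) : ∃ i, v ∈ Finsupp.supported R R (S i) := by
  rw [Finsupp.mem_supported] at hv
  exact hd.exists_mem_subset_of_finset_subset_biUnion hv

theorem pmap_chain {R : Type u} [CommRing R] {Z : Type u} {K : Submodule R (Z →₀ R)}
    {B : Type u} [AddCommGroup B] [Module R B] {ι : Type u} [Nonempty ι]
    (S : ι → Set Z) (p : ι → (Z →₀ R) →ₗ.[R] B)
    (hd : Directed (· ≤ ·) fun i => (S i, p i))
    (hp : ∀ i, (p i).domain = K ⊔ Finsupp.supported R R (S i)) :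
    ∃ p' : (Z →₀ R) →ₗ.[R] B, (∀ i, p i ≤ p') ∧
      p'.domain = K ⊔ Finsupp.supported R R (⋃ i, S i) := by
  have hdp : Directed (· ≤ ·) p := fun i j => by
    obtain ⟨k, h1, h2⟩ := hd i j
    exact ⟨k, h1.2, h2.2⟩
  have hdS : Directed (· ⊆ ·) S := fun i j => by
    obtain ⟨k, h1, h2⟩ := hd i j
    exact ⟨k, h1.1, h2.1⟩
  have hdo : DirectedOn (· ≤ ·) (Set.range p) := directedOn_range.2 hdp
  refine ⟨LinearPMap.sSup (Set.range p) hdo, fun i => LinearPMap.le_sSup hdo ⟨i, rfl⟩, ?_⟩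
  have hle : ∀ i, (p i).domain ≤ (LinearPMap.sSup (Set.range p) hdo).domain := fun i =>
    (LinearPMap.le_sSup hdo ⟨i, rfl⟩).1
  apply le_antisymm
  · rw [LinearPMap.domain_sSup]
    refine sSup_le ?_
    rintro _ ⟨_, ⟨i, rfl⟩, rfl⟩
    rw [hp]
    exact sup_le_sup_left (Finsupp.supported_mono (Set.subset_iUnion S i)) _
  · refine sup_le ?_ fun v hv => ?_
    · obtain ⟨i⟩ := ‹Nonempty ι›
      refine le_trans ?_ (hle i)
      rw [hp]
      exact le_sup_left
    · obtain ⟨i, hi⟩ := supported_directed S hdS v hv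
      apply hle i
      rw [hp]
      exact Submodule.mem_sup_right hi

theorem pmap_big {R : Type u} [CommRing R]
    (hsh : ∀ I : Ideal R, I.FG → Module.Projective R I)
    (Q : Type u) [CommRing Q] [Algebra R Q] [IsFractionRing R Q] [IsNoetherianRing Q]
    {Z : Type u} {K : Submodule R (Z →₀ R)}
    (s : K →ₗ[R] (K →₀ R)) (hs : ∀ k, Finsupp.linearCombination R id (s k) = k)
    {B : Type u} [AddCommGroup B] [Module R B]
    (hB : ∀ J : Ideal R, J.FG → ∀ f : J →ₗ[R] B, ∃ b, ∀ j : J, f j = (j : R) • b)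
    (S : Set Z) (hS : GoodSet s S) (x : Z) (p : (Z →₀ R) →ₗ.[R] B)
    (hp : p.domain = K ⊔ Finsupp.supported R R S) :
    ∃ (S' : Set Z) (p' : (Z →₀ R) →ₗ.[R] B), S ⊆ S' ∧ x ∈ S' ∧ GoodSet s S' ∧ p ≤ p' ∧
      p'.domain = K ⊔ Finsupp.supported R R S' := by
  classical
  let A := {y : Finset Z × ((Z →₀ R) →ₗ.[R] B) //
    y.2.domain = K ⊔ Finsupp.supported R R (S ∪ y.1)}
  have next : ∀ y : A, ∃ y' : A, y.1 ≤ y'.1 ∧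
      ∀ k : K, (k : Z →₀ R) ∈ Finsupp.supported R R (S ∪ y.1.1) → ∀ k' ∈ (s k).support,
        (k' : Z →₀ R) ∈ Finsupp.supported R R (S ∪ y'.1.1) := by
    rintro ⟨⟨X, q⟩, hq⟩
    obtain ⟨W, hW⟩ := good_finite Q s S hS X
    let X' : Finset Z := X ∪ W.biUnion fun k => (k : Z →₀ R).support
    obtain ⟨q', h1, h2⟩ := pmap_step_fin hsh Q s hs hB S hS X X' Finset.subset_union_left q hq
    refine ⟨⟨⟨X', q'⟩, h2⟩, ⟨Finset.subset_union_left, h1⟩, fun k hk k' hk' => ?_⟩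
    rcases hW k hk k' hk' with h | h
    · rw [Finsupp.mem_supported]
      intro z hz
      refine Or.inr ?_
      exact Finset.mem_coe.2 (Finset.mem_union_right _ (Finset.mem_biUnion.2 ⟨k', h, hz⟩))
    · exact Finsupp.supported_mono Set.subset_union_left h
  choose nx hnx1 hnx2 using next
  obtain ⟨p0, hp0, hp0d⟩ := pmap_step_fin hsh Q s hs hB S hS ∅ {x} (by simp) p (by rw [hp]; simp)
  let y0 : A := ⟨({x}, p0), hp0d⟩
  let y : ℕ → A := fun n => Nat.rec y0 (fun _ a => nx a) n
  have hmono : Monotone fun n => (y n).1 := monotone_nat_of_le_succ fun n => hnx1 (y n)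
  let SS : ULift.{u} ℕ → Set Z := fun n => S ∪ (y n.down).1.1
  have hdir : Directed (· ≤ ·) fun n : ULift.{u} ℕ => (SS n, (y n.down).1.2) := by
    apply Monotone.directed_le
    intro m n hmn
    have := hmono (show m.down ≤ n.down from hmn)
    exact ⟨Set.union_subset_union_right _ (by exact_mod_cast this.1), this.2⟩
  have hdirS : Directed (· ⊆ ·) SS := fun i j => by
    obtain ⟨k, h1, h2⟩ := hdir i j
    exact ⟨k, h1.1, h2.1⟩
  obtain ⟨p', h1, h2⟩ := pmap_chain SS (fun n => (y n.down).1.2) hdir (fun n => (y n.down).2)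
  refine ⟨⋃ n, SS n, p', ?_, ?_, ?_, ?_, h2⟩
  · exact Set.subset_union_left.trans (Set.subset_iUnion SS ⟨0⟩)
  · exact Set.mem_iUnion.2 ⟨⟨0⟩, Or.inr (by simp [y, y0])⟩
  · intro k hk k' hk'
    obtain ⟨n, hn⟩ := supported_directed SS hdirS (k : Z →₀ R) hk
    have := hnx2 (y n.down) k hn k' hk'
    exact Finsupp.supported_mono (Set.subset_iUnion SS ⟨n.down + 1⟩) this
  · exact hp0.trans (h1 ⟨0⟩)

theorem extend_all {R : Type u} [CommRing R]
    (hsh : ∀ I : Ideal R, I.FG → Module.Projective R I)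
    (Q : Type u) [CommRing Q] [Algebra R Q] [IsFractionRing R Q] [IsNoetherianRing Q]
    {Z : Type u} (K : Submodule R (Z →₀ R)) (hK : Module.Projective R K)
    {B : Type u} [AddCommGroup B] [Module R B]
    (hB : ∀ J : Ideal R, J.FG → ∀ f : J →ₗ[R] B, ∃ b, ∀ j : J, f j = (j : R) • b)
    (h : K →ₗ[R] B) : ∃ h' : (Z →₀ R) →ₗ[R] B, ∀ k : K, h' k = h k := by
  classical
  obtain ⟨s, hs⟩ := hK.out
  let p0 : (Z →₀ R) →ₗ.[R] B := ⟨K, h⟩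
  let C : Set (Set Z × ((Z →₀ R) →ₗ.[R] B)) :=
    {c | GoodSet s c.1 ∧ c.2.domain = K ⊔ Finsupp.supported R R c.1}
  have h0 : ((∅, p0) : Set Z × ((Z →₀ R) →ₗ.[R] B)) ∈ C := by
    refine ⟨?_, by simp [p0]⟩
    intro k hk k' hk'
    have : k = 0 := by simpa using hk
    subst this
    simp at hk'
  obtain ⟨⟨S, p⟩, hle, hmax⟩ := zorn_le_nonempty₀ C (by
    intro c hcC hc y hy
    have : Nonempty c := ⟨⟨y, hy⟩⟩
    have hdir : Directed (· ≤ ·) fun i : c => ((i.1.1, i.1.2) : Set Z × ((Z →₀ R) →ₗ.[R] B)) :=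
      hc.directed
    have hdirS : Directed (· ⊆ ·) fun i : c => i.1.1 := fun i j => by
      obtain ⟨k, h1, h2⟩ := hdir i j
      exact ⟨k, h1.1, h2.1⟩
    obtain ⟨p', h1, h2⟩ := pmap_chain (fun i : c => i.1.1) (fun i : c => i.1.2) hdir
      (fun i => (hcC i.2).2)
    refine ⟨(⋃ i : c, i.1.1, p'), ⟨?_, h2⟩, fun z hz => ⟨?_, h1 ⟨z, hz⟩⟩⟩
    · intro k hk k' hk'
      obtain ⟨i, hi⟩ := supported_directed _ hdirS (k : Z →₀ R) hk
      exact Finsupp.supported_mono (Set.subset_iUnion (fun i : c => i.1.1) i)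
        ((hcC i.2).1 k hi k' hk')
    · exact Set.subset_iUnion (fun i : c => i.1.1) ⟨z, hz⟩) _ h0
  have hS : ∀ x, x ∈ S := by
    intro x
    obtain ⟨S', p', h1, h2, h3, h4, h5⟩ := pmap_big hsh Q s hs hB S hmax.prop.1 x p hmax.prop.2
    have := hmax.le_of_ge (y := (S', p')) ⟨h3, h5⟩ ⟨h1, h4⟩
    exact this.1 h2
  have hdom : p.domain = ⊤ := by
    rw [hmax.prop.2, Set.eq_univ_of_forall hS, Finsupp.supported_univ, sup_top_eq]
  refine ⟨p.toFun ∘ₗ (LinearEquiv.ofTop _ hdom).symm.toLinearMap, fun k => ?_⟩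
  exact (hle.2.2 (x := k) (y := ⟨(k : Z →₀ R), hdom ▸ trivial⟩) rfl).symm

theorem projective_ker_free {R : Type u} [CommRing R] {P M : Type u} [AddCommGroup P] [Module R P]
    [AddCommGroup M] [Module R M] [Module.Projective R P] (g : P →ₗ[R] M)
    (hk : Module.Projective R (LinearMap.ker g)) :
    Module.Projective R (LinearMap.ker (g ∘ₗ Finsupp.linearCombination R (id : P → P))) := by
  let l : (P →₀ R) →ₗ[R] P := Finsupp.linearCombination R (id : P → P)
  obtain ⟨s, hs⟩ := Module.projective_def'.1 ‹Module.Projective R P›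
  have hs' : ∀ q, l (s q) = q := fun q => LinearMap.congr_fun hs q
  change Module.Projective R (LinearMap.ker (g ∘ₗ l))
  let a : LinearMap.ker (g ∘ₗ l) →ₗ[R] (LinearMap.ker g × (P →₀ R)) :=
    LinearMap.prod ((l ∘ₗ (LinearMap.ker (g ∘ₗ l)).subtype).codRestrict _ (fun v => v.2))
      ((LinearMap.id - s ∘ₗ l) ∘ₗ (LinearMap.ker (g ∘ₗ l)).subtype)
  let b : (LinearMap.ker g × (P →₀ R)) →ₗ[R] LinearMap.ker (g ∘ₗ l) :=
    (LinearMap.coprod (s ∘ₗ (LinearMap.ker g).subtype) (LinearMap.id - s ∘ₗ l)).codRestrict _ (by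
      rintro ⟨⟨k, hk⟩, w⟩
      have hk0 : g k = 0 := hk
      simp [hs', hk0])
  refine Module.Projective.of_split a b ?_
  apply LinearMap.ext
  intro v
  apply Subtype.ext
  have e : (s (l v) : P →₀ R) + ((v : P →₀ R) - s (l v)) = v := by abel
  change s (l v) + (((v : P →₀ R) - s (l v)) - s (l ((v : P →₀ R) - s (l v)))) = v
  rw [map_sub l, hs', sub_self, map_zero, sub_zero]
  exact e

theorem closed_of_semisimple {R : Type u} [CommRing R]
    (hsh : ∀ I : Ideal R, I.FG → Module.Projective R I)
    (Q : Type u) [CommRing Q] [Algebra R Q] [IsFractionRing R Q] (hQ : IsSemisimpleRing Q)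
    (ι : Type u) (B : ι → ModuleCat.{u} R) (hB : ∀ i, B i ∈ BClass R) :
    ModuleCat.of R (DirectSum ι (fun i => (B i : Type u))) ∈ BClass R := by
  classical
  have hBx : ∀ i, ∀ J : Ideal R, J.FG → ∀ f : J →ₗ[R] B i, ∃ b, ∀ j : J, f j = (j : R) • b := by
    intro i J hJ f
    have hker : LinearMap.ker J.mkQ = J := J.ker_mkQ
    have hpd : ProjDimLE1 R (R ⧸ J) :=
      ⟨ModuleCat.of R R, J.mkQ, inferInstanceAs (Module.Projective R R), J.mkQ_surjective, by
        rw [hker]; exact hsh J hJ⟩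
    obtain ⟨f', hf'⟩ := extend_of_ext1 (P := R) (hB i (ModuleCat.of R (R ⧸ J)) hpd) J.mkQ
      J.mkQ_surjective (f ∘ₗ (LinearEquiv.ofEq _ _ hker).toLinearMap)
    refine ⟨f' 1, fun j => ?_⟩
    rw [← map_smul, smul_eq_mul, mul_one]
    exact (hf' ⟨j, hker.symm ▸ j.2⟩).symm
  have hsum : ∀ J : Ideal R, J.FG → ∀ f : J →ₗ[R] DirectSum ι (fun i => (B i : Type u)),
      ∃ b, ∀ j : J, f j = (j : R) • b := by
    intro J hJ f
    have hfin : Module.Finite R J := Module.Finite.iff_fg.2 hJ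
    obtain ⟨T, hT⟩ := hfin.fg_top
    let F : Finset ι := T.biUnion fun j => DFinsupp.support (f j)
    have hF : ∀ j : J, ∀ i, i ∉ F → f j i = 0 := by
      intro j i hi
      have hj : j ∈ Submodule.span R (T : Set J) := hT ▸ trivial
      induction hj using Submodule.span_induction with
      | mem j hj =>
        by_contra hne
        exact hi (Finset.mem_biUnion.2 ⟨j, hj, DFinsupp.mem_support_iff.2 hne⟩)
      | zero => rw [map_zero]; rfl
      | add x y _ _ hx hy => rw [map_add, DirectSum.add_apply, hx, hy, add_zero]
      | smul r x _ hx => rw [map_smul, DirectSum.smul_apply, hx, smul_zero]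
    choose b hb using fun i => hBx i J hJ (DirectSum.component R ι (fun i => (B i : Type u)) i ∘ₗ f)
    refine ⟨DirectSum.mk (fun i => (B i : Type u)) F fun i => b i, fun j => ?_⟩
    refine DFinsupp.ext fun i => ?_
    by_cases hi : i ∈ F
    · have := hb i j
      refine this.trans ?_
      rw [DirectSum.smul_apply, DirectSum.mk_apply_of_mem hi]
    · refine (hF j i hi).trans ?_
      rw [DirectSum.smul_apply, DirectSum.mk_apply_of_notMem hi, smul_zero]
  rintro M ⟨P, g, hP, hg, hk⟩
  have hpk := projective_ker_free g hk
  refine ext1_of_extend (g ∘ₗ Finsupp.linearCombination R (id : P → P)) ?_ ?_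
  · rw [LinearMap.coe_comp]
    exact hg.comp (Finsupp.linearCombination_id_surjective R P)
  · exact fun f => extend_all hsh Q _ hpk hsum f

/-- **Proposition 6.1.** Let `R` be a commutative semihereditary ring with total ring of
quotients `Q`. The following are equivalent: (i) `ℬ(R)` is closed under direct sums
(i.e. the cotorsion pair `(𝒫₁(R), ℬ(R))` is of finite type); (ii) `Q` is semisimple;
(iii) `R` is a finite direct product of Prüfer domains (= semihereditary commutative
integral domains). -/
theorem finite_type_iff_semisimple_iff_product_of_prufer (R : Type u) [CommRing R]
    (hsh : ∀ I : Ideal R, I.FG → Module.Projective R I)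
    (Q : Type u) [CommRing Q] [Algebra R Q] [IsFractionRing R Q] :
    ((∀ (ι : Type u) (B : ι → ModuleCat.{u} R), (∀ i, B i ∈ BClass R) →
        ModuleCat.of R (DirectSum ι (fun i => (B i : Type u))) ∈ BClass R) ↔
      IsSemisimpleRing Q) ∧
    (IsSemisimpleRing Q ↔
      ∃ (n : ℕ) (D : Fin n → CommRingCat.{u}),
        (∀ i, IsDomain (D i)) ∧
        (∀ i, ∀ I : Ideal (D i), I.FG → Module.Projective (D i) I) ∧
        Nonempty (R ≃+* ((i : Fin n) → (D i : Type u)))) := by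
  have hiff1 := fun hQ : IsSemisimpleRing Q => prod_of_semisimple hsh Q hQ
  refine ⟨⟨fun hB => semisimple_of_no_chain hsh Q (no_chain_of_closed hB),
    fun hQ ι B hB => closed_of_semisimple hsh Q hQ ι B hB⟩, hiff1, ?_⟩
  rintro ⟨n, D, hD, -, ⟨φ⟩⟩
  exact semisimple_of_no_chain hsh Q (no_chain_of_prod n D hD φ)
end
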